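/- Let μ be an ergodic translation-invariant Gibbs measure for the 1-2 model on the hexagonal lattice ℍ (with any weights a, b, c > 0) such that μ-almost surely the number of infinite {001}-clusters is infinite. Then there exists N ≥ 1 such that μ({ω ∈ Ω : B_N is an encounter box for ω}) > 0. -/

import Mathlib

open MeasureTheory

/-- Vertices of the hexagonal lattice: `(x, y, t)` with `t = true` the "upper" vertex. -/
abbrev HexV : Type := ℤ × ℤ × Bool

/-- Edges of the hexagonal lattice: `(x, y, k)` with `k = 0` the a-type (horizontal) edge
joining `(x,y,1)` to `(x,y,0)`, `k = 1` the b-type edge joining `(x,y,1)` to `(x+1,y,0)`,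
`k = 2` the c-type edge joining `(x,y,1)` to `(x,y+1,0)`. -/
abbrev HexE : Type := ℤ × ℤ × Fin 3

/-- A configuration assigns present/absent to each edge. -/
abbrev Config : Type := HexE → Bool

def end1 (e : HexE) : HexV := (e.1, e.2.1, true)

def end2 (e : HexE) : HexV :=
  if e.2.2 = 0 then (e.1, e.2.1, false)
  else if e.2.2 = 1 then (e.1 + 1, e.2.1, false)
  else (e.1, e.2.1 + 1, false)

/-- The edges incident to a vertex, indexed so that index `0` is the a-type (horizontal)
edge, index `1` the b-type edge, index `2` the c-type edge. -/
def edgesAt (v : HexV) : Fin 3 → HexE := fun i =>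
  if v.2.2 then (v.1, v.2.1, i)
  else if i = 0 then (v.1, v.2.1, 0)
  else if i = 1 then (v.1 - 1, v.2.1, 1)
  else (v.1, v.2.1 - 1, 2)

/-- Local configuration of `ω` at `v`: digit `0` (rightmost) is the a-type edge,
digit `1` the b-type edge, digit `2` (leftmost) the c-type edge. -/
def localConf (ω : Config) (v : HexV) : Fin 3 → Bool := fun i => ω (edgesAt v i)

/-- A 1-2 model configuration: every vertex is incident to one or two present edges. -/
def IsConfig (ω : Config) : Prop :=
  ∀ v : HexV,
    1 ≤ (Finset.univ.filter fun i : Fin 3 => localConf ω v i = true).card ∧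
    (Finset.univ.filter fun i : Fin 3 => localConf ω v i = true).card ≤ 2

/-- The local configuration type `{001}` : only the a-type (horizontal) edge is present. -/
def conf001 : Fin 3 → Bool := ![true, false, false]

/-- The six admissible local configuration types `{001},…,{110}`. -/
def validConf (τ : Fin 3 → Bool) : Prop :=
  τ ≠ ![false, false, false] ∧ τ ≠ ![true, true, true]

/-- Vertex weight: `w(001)=w(110)=a`, `w(010)=w(101)=b`, `w(011)=w(100)=c`. -/
def weight (a b c : ℝ) (f : Fin 3 → Bool) : ℝ :=
  match f 2, f 1, f 0 with
  | false, false, true  => a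
  | true,  true,  false => a
  | false, true,  false => b
  | true,  false, true  => b
  | false, true,  true  => c
  | true,  false, false => c
  | false, false, false => 0
  | true,  true,  true  => 0

/-- Adjacency in the hexagonal lattice. -/
def HexAdj (v w : HexV) : Prop :=
  v ≠ w ∧ ∃ e : HexE, (v = end1 e ∨ v = end2 e) ∧ (w = end1 e ∨ w = end2 e)

/-- Adjacency restricted to a vertex set `S`. -/
def adjIn (S : Set HexV) (v w : HexV) : Prop := HexAdj v w ∧ v ∈ S ∧ w ∈ S

/-- The connected component of `v` in the subgraph induced on `S`. -/
def compOf (S : Set HexV) (v : HexV) : Set HexV := {w | Relation.ReflTransGen (adjIn S) v w}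

/-- `C` is a connected component of the subgraph induced on `S`. -/
def IsCompOf (S : Set HexV) (C : Set HexV) : Prop := ∃ v ∈ S, C = compOf S v

/-- Vertices whose local configuration equals `τ`. -/
def confSet (ω : Config) (τ : Fin 3 → Bool) : Set HexV := {v | localConf ω v = τ}

/-- A `τ`-cluster of `ω`. -/
def IsCluster (ω : Config) (τ : Fin 3 → Bool) (C : Set HexV) : Prop :=
  IsCompOf (confSet ω τ) C

/-- The number of infinite `τ`-clusters of `ω`, as an extended natural number. -/
noncomputable def numInfClusters (ω : Config) (τ : Fin 3 → Bool) : ℕ∞ :=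
  {C : Set HexV | IsCluster ω τ C ∧ C.Infinite}.encard

def endsFinset (e : HexE) : Finset HexV := {end1 e, end2 e}

/-- Vertices incident to an edge of `F`. -/
def verts (F : Finset HexE) : Finset HexV := F.biUnion endsFinset

/-- Edges sharing an endpoint with an edge of `F`. -/
def edgeNbhd (F : Finset HexE) : Set HexE :=
  {e' | ∃ e ∈ F,
    end1 e = end1 e' ∨ end1 e = end2 e' ∨ end2 e = end1 e' ∨ end2 e = end2 e'}

/-- Cylinder event: configurations agreeing with `σ` on `S`. -/
def cyl (S : Set HexE) (σ : Config) : Set Config := {ω | ∀ e ∈ S, ω e = σ e}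

/-- A Gibbs measure for the 1-2 model with weights `a`, `b`, `c`. -/
def IsGibbs (a b c : ℝ) (μ : Measure Config) : Prop :=
  IsProbabilityMeasure μ ∧ μ {ω | IsConfig ω} = 1 ∧
  ∀ F : Finset HexE, ∀ σ τ : Config, IsConfig σ → IsConfig τ →
    (∀ e ∉ F, σ e = τ e) →
    μ (cyl (↑F ∪ edgeNbhd F) σ) *
        ENNReal.ofReal (∏ v ∈ verts F, weight a b c (localConf τ v)) =
      μ (cyl (↑F ∪ edgeNbhd F) τ) *
        ENNReal.ofReal (∏ v ∈ verts F, weight a b c (localConf σ v))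

/-- Translation of edges by `g ∈ ℤ²`. -/
def shiftE (g : ℤ × ℤ) (e : HexE) : HexE := (e.1 + g.1, e.2.1 + g.2, e.2.2)

/-- Induced translation action on configurations. -/
def shiftConfig (g : ℤ × ℤ) (ω : Config) : Config := fun e => ω (shiftE g e)

/-- Translation invariance of a measure on configurations. -/
def TransInvariant (μ : Measure Config) : Prop :=
  ∀ g : ℤ × ℤ, μ.map (shiftConfig g) = μ

/-- Ergodicity: every translation-invariant measurable event has measure `0` or `1`. -/
def IsErgodicTI (μ : Measure Config) : Prop :=
  ∀ A : Set Config, MeasurableSet A → (∀ g, shiftConfig g ⁻¹' A = A) → μ A = 0 ∨ μ A = 1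

/-- The box `B_n(i,j)`. -/
def box (n : ℕ) (i j : ℤ) : Set HexV :=
  {v | |v.1 - i| ≤ (n : ℤ) ∧ |v.2.1 - j| ≤ (n : ℤ)}

/-- Vertices outside `B` adjacent to a vertex of `B`. -/
def outerBoundary (B : Set HexV) : Set HexV := {v | v ∉ B ∧ ∃ w ∈ B, HexAdj v w}

/-- `B_N(i,j)` is an encounter box for `ω` with respect to the infinite `{001}`-cluster `C`. -/
def IsEncounterBoxWrt (ω : Config) (N : ℕ) (i j : ℤ) (C : Set HexV) : Prop :=
  IsCluster ω conf001 C ∧ C.Infinite ∧ box N i j ⊆ C ∧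
  (∀ D, IsCompOf (C \ box (N + 2) i j) D → D.Infinite) ∧
  {D : Set HexV | IsCompOf (C \ box (N + 2) i j) D ∧ D.Infinite}.encard = 3

/-- `B_N(i,j)` is an encounter box for `ω`. -/
def IsEncounterBox (ω : Config) (N : ℕ) (i j : ℤ) : Prop :=
  ∃ C : Set HexV, IsEncounterBoxWrt ω N i j C

/-- A 3-partition of `Y`: an unordered triple of pairwise disjoint nonempty sets with union `Y`. -/
def IsThreePartition {α : Type*} (Y : Set α) (P : Set (Set α)) : Prop :=
  ∃ P₁ P₂ P₃ : Set α, P = {P₁, P₂, P₃} ∧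
    P₁.Nonempty ∧ P₂.Nonempty ∧ P₃.Nonempty ∧
    Disjoint P₁ P₂ ∧ Disjoint P₁ P₃ ∧ Disjoint P₂ P₃ ∧
    P₁ ∪ P₂ ∪ P₃ = Y

/-- Two 3-partitions are compatible if their parts can be ordered so that `Q₂ ∪ Q₃ ⊆ P₁`. -/
def CompatiblePartitions {α : Type*} (P Q : Set (Set α)) : Prop :=
  ∃ P₁ ∈ P, ∃ Q₁ ∈ Q, ∀ R ∈ Q, R ≠ Q₁ → R ⊆ P₁


namespace OT

def nae (a b c : Bool) : Prop := ¬ (a = b ∧ b = c)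

instance (a b c : Bool) : Decidable (nae a b c) := by unfold nae; infer_instance

/-- new a-edges -/
def fA (M : ℤ) (α β : ℤ → ℤ → Bool) (x k : ℤ) : Bool :=
  if -M ≤ x ∧ x ≤ M ∧ -M + 1 ≤ k ∧ k ≤ M then
    (if x = M - 1 ∧ k = M then !(β M M)
      else if x = -M + 1 ∧ k = -M + 1 then !(β (-M-1) (-M)) else true)
  else α x k

/-- new b-edges -/
def fB (M : ℤ) (β : ℤ → ℤ → Bool) (x k : ℤ) : Bool :=
  if -M ≤ x ∧ x ≤ M - 1 ∧ -M ≤ k ∧ k ≤ M then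
    (if x = M - 1 ∧ k = M then β M M
      else if x = -M ∧ k = -M then β (-M-1) (-M) else false)
  else β x k

open Classical in
/-- new c-edges -/
noncomputable def fC (M : ℤ) (Z : ℤ → ℤ → Prop) (α β γ : ℤ → ℤ → Bool) (x k : ℤ) : Bool :=
  if -M ≤ x ∧ x ≤ M ∧ -M ≤ k ∧ k ≤ M then
    (if Z x k then false else
      !(fA M α β x (k+1) && fB M β (x-1) k) && !(fA M α β x k && fB M β x k))
  else γ x k

lemma fill_bulk (M : ℤ) (hM : 5 ≤ M) (Z : ℤ → ℤ → Prop) (α β γ : ℤ → ℤ → Bool)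
    (hU : ∀ x k, nae (α x k) (β x k) (γ x k))
    (hD : ∀ x k, nae (α x (k+1)) (β (x-1) k) (γ x k))
    (hZR : ∀ x k, Z x k → -M ≤ x ∧ x ≤ M ∧ -M ≤ k ∧ k ≤ M)
    (hZ1 : ∀ x k, Z x k → (-M + 3 ≤ x ∧ x ≤ M - 3) ∨ (-M + 3 ≤ k ∧ k ≤ M - 3))
    (hT : ∀ x, Z x M → α x (M+1) = true)
    (hBo : ∀ x, Z x (-M) → α x (-M) = true)
    (hL : ∀ k, Z (-M) k → β (-M-1) k = false)
    (hR : ∀ k, Z M k → β M k = false) :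
    (∀ x k, nae (fA M α β x k) (fB M β x k) (fC M Z α β γ x k)) ∧
    (∀ x k, nae (fA M α β x (k+1)) (fB M β (x-1) k) (fC M Z α β γ x k)) ∧
    (∀ x k, Z x k → fA M α β x k = true ∧ fB M β x k = false ∧ fC M Z α β γ x k = false ∧
      fA M α β x (k+1) = true ∧ fB M β (x-1) k = false) ∧
    (∀ x k, -M ≤ x → x ≤ M → -M ≤ k → k ≤ M → ¬ Z x k → fA M α β x k = true → 
      fB M β x k = false → fC M Z α β γ x k = false → x = -M ∧ -M < k) ∧
    (∀ x k, -M ≤ x → x ≤ M → -M ≤ k → k ≤ M → ¬ Z x k → fA M α β x (k+1) = true → 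
      fB M β (x-1) k = false → fC M Z α β γ x k = false → x = M ∧ k < M) := by
  have hZs : ∀ x k, Z x k → fA M α β x k = true ∧ fB M β x k = false ∧ fC M Z α β γ x k = false ∧
      fA M α β x (k+1) = true ∧ fB M β (x-1) k = false := by
    intro x k hz
    have h0 := hZR x k hz
    have h1 := hZ1 x k hz
    refine ⟨?_, ?_, ?_, ?_, ?_⟩
    · unfold fA
      split_ifs with h2 h3 h4
      · omega
      · omega
      · rfl
      · have : k = -M := by omega
        subst this
        exact hBo x hz
    · unfold fB
      split_ifs with h2 h3 h4
      · omega
      · omega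
      · rfl
      · have : x = M := by omega
        subst this
        exact hR k hz
    · unfold fC
      rw [if_pos h0, if_pos hz]
    · unfold fA
      split_ifs with h2 h3 h4
      · omega
      · omega
      · rfl
      · have : k = M := by omega
        subst this
        exact hT x hz
    · unfold fB
      split_ifs with h2 h3 h4
      · omega
      · omega
      · rfl
      · have : x = -M := by omega
        subst this
        exact hL k hz
  have hbl : ∀ x k, -M ≤ x → x ≤ M → -M ≤ k → k ≤ M → fA M α β x (k+1) = true →
      fB M β (x-1) k = true → (x = -M) ∨ (x = M ∧ fB M β x k = true ∧ fA M α β x k = true) := by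
    intro x k h1 h2 h3 h4 hA hB
    by_cases hx : x = -M
    · exact Or.inl hx
    right
    unfold fB at hB
    rw [if_pos (by omega)] at hB
    split_ifs at hB with h5 h6
    · have e1 : x = M := by omega
      have e2 : k = M := by omega
      subst e1; subst e2
      refine ⟨rfl, ?_, ?_⟩
      · unfold fB; rw [if_neg (by omega)]; exact hB
      · unfold fA; rw [if_pos (by omega), if_neg (by omega), if_neg (by omega)]
    · exfalso
      unfold fA at hA
      rw [if_pos (by omega), if_neg (by omega), if_pos (by omega), hB] at hA
      simp at hA
  have hbr : ∀ x k, -M ≤ x → x ≤ M → -M ≤ k → k ≤ M → fA M α β x k = true →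
      fB M β x k = true → (x = M) ∨ (x = -M ∧ fB M β (x-1) k = true ∧ fA M α β x (k+1) = true) := by
    intro x k h1 h2 h3 h4 hA hB
    by_cases hx : x = M
    · exact Or.inl hx
    right
    unfold fB at hB
    rw [if_pos (by omega)] at hB
    split_ifs at hB with h5 h6
    · exfalso
      unfold fA at hA
      rw [if_pos (by omega), if_pos (by omega), hB] at hA
      simp at hA
    · obtain ⟨e1, e2⟩ := h6
      subst e1; subst e2
      refine ⟨rfl, ?_, ?_⟩
      · unfold fB; rw [if_neg (by omega)]; exact hB
      · unfold fA; rw [if_pos (by omega), if_neg (by omega), if_neg (by omega)]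
  have hCin : ∀ x k, -M ≤ x → x ≤ M → -M ≤ k → k ≤ M → ¬ Z x k → 
      fC M Z α β γ x k = (!(fA M α β x (k+1) && fB M β (x-1) k) && !(fA M α β x k && fB M β x k)) := by
    intro x k h1 h2 h3 h4 hz
    unfold fC
    rw [if_pos (by omega), if_neg hz]
  have hJU : ∀ x k, -M ≤ x → x ≤ M → -M ≤ k → k ≤ M → ¬ Z x k → fA M α β x k = true → 
      fB M β x k = false → fC M Z α β γ x k = false → x = -M ∧ -M < k := by
    intro x k h1 h2 h3 h4 hz hA hB hC
    rw [hCin x k h1 h2 h3 h4 hz, hA, hB] at hC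
    simp at hC
    rcases hbl x k h1 h2 h3 h4 hC.1 hC.2 with h | h
    · refine ⟨h, ?_⟩
      by_contra hk
      have e2 : k = -M := by omega
      subst h; subst e2
      have h5 := hC.2
      unfold fB at h5 hB
      rw [if_neg (by omega)] at h5
      rw [if_pos (by omega), if_neg (by omega), if_pos (by omega), h5] at hB
      simp at hB
    · rw [hB] at h; simp at h
  have hJD : ∀ x k, -M ≤ x → x ≤ M → -M ≤ k → k ≤ M → ¬ Z x k → fA M α β x (k+1) = true → 
      fB M β (x-1) k = false → fC M Z α β γ x k = false → x = M ∧ k < M := by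
    intro x k h1 h2 h3 h4 hz hA hB hC
    rw [hCin x k h1 h2 h3 h4 hz, hA, hB] at hC
    simp at hC
    rcases hbr x k h1 h2 h3 h4 hC.1 hC.2 with h | h
    · refine ⟨h, ?_⟩
      by_contra hk
      have e2 : k = M := by omega
      subst h; subst e2
      have h5 := hC.2
      unfold fB at h5 hB
      rw [if_neg (by omega)] at h5
      rw [if_pos (by omega), if_pos (by omega), h5] at hB
      simp at hB
    · rw [hB] at h; simp at h
  -- both-false facts
  have hU0 : ∀ x k, -M ≤ x → x ≤ M → -M ≤ k → k ≤ M → fA M α β x k = false →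
      fB M β x k = false → ¬ (fA M α β x (k+1) = true ∧ fB M β (x-1) k = true) := by
    rintro x k h1 h2 h3 h4 hA hB ⟨hA', hB'⟩
    rcases hbl x k h1 h2 h3 h4 hA' hB' with h | h
    · subst h
      unfold fA at hA
      split_ifs at hA with h5 h6 h7
      · omega
      · omega
      · have e2 : k = -M := by omega
        subst e2
        unfold fB at hB hB'
        rw [if_neg (by omega)] at hB'
        rw [if_pos (by omega), if_neg (by omega), if_pos (by omega), hB'] at hB
        simp at hB
    · rw [hA] at h; simp at h
  have hD0 : ∀ x k, -M ≤ x → x ≤ M → -M ≤ k → k ≤ M → fA M α β x (k+1) = false →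
      fB M β (x-1) k = false → ¬ (fA M α β x k = true ∧ fB M β x k = true) := by
    rintro x k h1 h2 h3 h4 hA hB ⟨hA', hB'⟩
    rcases hbr x k h1 h2 h3 h4 hA' hB' with h | h
    · subst h
      unfold fA at hA
      split_ifs at hA with h5 h6 h7
      · omega
      · omega
      · have e2 : k = x := by omega
        subst e2
        unfold fB at hB hB'
        rw [if_neg (by omega)] at hB'
        rw [if_pos (by omega), if_pos (by omega), hB'] at hB
        simp at hB
    · rw [hA] at h; simp at h
  refine ⟨?_, ?_, hZs, hJU, hJD⟩
  · intro x k
    by_cases hin : -M ≤ x ∧ x ≤ M ∧ -M ≤ k ∧ k ≤ M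
    · obtain ⟨h1, h2, h3, h4⟩ := hin
      by_cases hz : Z x k
      · obtain ⟨e1, e2, e3, -, -⟩ := hZs x k hz
        rw [e1, e2, e3]; decide
      · have h5 := hU0 x k h1 h2 h3 h4
        rw [hCin x k h1 h2 h3 h4 hz]
        revert h5
        generalize fA M α β x k = p1
        generalize fB M β x k = p2
        generalize fA M α β x (k+1) = p3
        generalize fB M β (x-1) k = p4
        revert p1 p2 p3 p4
        decide
    · have e1 : fA M α β x k = α x k := by unfold fA; rw [if_neg (by omega)]
      have e2 : fB M β x k = β x k := by unfold fB; rw [if_neg (by omega)]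
      have e3 : fC M Z α β γ x k = γ x k := by unfold fC; rw [if_neg hin]
      rw [e1, e2, e3]; exact hU x k
  · intro x k
    by_cases hin : -M ≤ x ∧ x ≤ M ∧ -M ≤ k ∧ k ≤ M
    · obtain ⟨h1, h2, h3, h4⟩ := hin
      by_cases hz : Z x k
      · obtain ⟨-, -, e3, e1, e2⟩ := hZs x k hz
        rw [e1, e2, e3]; decide
      · have h5 := hD0 x k h1 h2 h3 h4
        rw [hCin x k h1 h2 h3 h4 hz]
        revert h5
        generalize fA M α β x k = p1
        generalize fB M β x k = p2
        generalize fA M α β x (k+1) = p3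
        generalize fB M β (x-1) k = p4
        revert p1 p2 p3 p4
        decide
    · have e1 : fA M α β x (k+1) = α x (k+1) := by unfold fA; rw [if_neg (by omega)]
      have e2 : fB M β (x-1) k = β (x-1) k := by unfold fB; rw [if_neg (by omega)]
      have e3 : fC M Z α β γ x k = γ x k := by unfold fC; rw [if_neg hin]
      rw [e1, e2, e3]; exact hD x k

lemma mem_S_true (ω : Config) (x y : ℤ) : ((x, y, true) : HexV) ∈ confSet ω conf001 ↔
    ω (x, y, 0) = true ∧ ω (x, y, 1) = false ∧ ω (x, y, 2) = false := by
  simp only [confSet, Set.mem_ofPred_eq, conf001, funext_iff, localConf, edgesAt, Fin.forall_fin_succ]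
  simp

lemma mem_S_false (ω : Config) (x y : ℤ) : ((x, y, false) : HexV) ∈ confSet ω conf001 ↔
    ω (x, y, 0) = true ∧ ω (x-1, y, 1) = false ∧ ω (x, y-1, 2) = false := by
  simp only [confSet, Set.mem_ofPred_eq, conf001, funext_iff, localConf, edgesAt, Fin.forall_fin_succ]
  simp

lemma nae_iff (f : Fin 3 → Bool) :
    (1 ≤ (Finset.univ.filter fun i : Fin 3 => f i = true).card ∧
    (Finset.univ.filter fun i : Fin 3 => f i = true).card ≤ 2) ↔ nae (f 0) (f 1) (f 2) := by
  revert f; decide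

lemma isConfig_iff (ω : Config) : IsConfig ω ↔
    (∀ x y, nae (ω (x, y, 0)) (ω (x, y, 1)) (ω (x, y, 2))) ∧
    (∀ x y, nae (ω (x, y, 0)) (ω (x-1, y, 1)) (ω (x, y-1, 2))) := by
  unfold IsConfig
  simp only [nae_iff]
  constructor
  · intro h
    refine ⟨fun x y => ?_, fun x y => ?_⟩
    · simpa [localConf, edgesAt] using h (x, y, true)
    · simpa [localConf, edgesAt] using h (x, y, false)
  · rintro ⟨h1, h2⟩ ⟨x, y, t⟩
    cases t
    · simpa [localConf, edgesAt] using h2 x y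
    · simpa [localConf, edgesAt] using h1 x y

def sk (v : HexV) : ℤ := if v.2.2 then v.1 + v.2.1 else v.1 + v.2.1 - 1

lemma sk_true (x y : ℤ) : sk (x, y, true) = x + y := rfl
lemma sk_false (x y : ℤ) : sk (x, y, false) = x + y - 1 := rfl

def Reg (M : ℤ) : Set HexV := {v | -M ≤ v.1 ∧ v.1 ≤ M ∧ -M ≤ sk v ∧ sk v ≤ M}

lemma fill (M : ℤ) (hM : 5 ≤ M) (Z : ℤ → ℤ → Prop) (ω : Config) (hω : IsConfig ω)
    (hZR : ∀ x k, Z x k → -M ≤ x ∧ x ≤ M ∧ -M ≤ k ∧ k ≤ M)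
    (hZ1 : ∀ x k, Z x k → (-M + 3 ≤ x ∧ x ≤ M - 3) ∨ (-M + 3 ≤ k ∧ k ≤ M - 3))
    (hT : ∀ x, Z x M → (x, M + 1 - x, true) ∈ confSet ω conf001)
    (hB : ∀ x, Z x (-M) → (x, -M - x, false) ∈ confSet ω conf001)
    (hL : ∀ k, Z (-M) k → (-M - 1, k + M + 1, true) ∈ confSet ω conf001)
    (hR : ∀ k, Z M k → (M + 1, k - M, false) ∈ confSet ω conf001) :
    ∃ ω' : Config, IsConfig ω' ∧ {e | ω e ≠ ω' e}.Finite ∧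
      (∀ v, v ∉ Reg M → (v ∈ confSet ω' conf001 ↔ v ∈ confSet ω conf001)) ∧
      (∀ v, Z v.1 (sk v) → v ∈ confSet ω' conf001) ∧
      (∀ v, v ∈ Reg M → v ∈ confSet ω' conf001 → ¬ Z v.1 (sk v) →
        (v.2.2 = true ∧ v.1 = -M ∧ -M < sk v) ∨ (v.2.2 = false ∧ v.1 = M ∧ sk v < M)) := by
  rw [isConfig_iff] at hω
  obtain ⟨hω1, hω2⟩ := hω
  let α : ℤ → ℤ → Bool := fun x k => ω (x, k - x, 0)
  let β : ℤ → ℤ → Bool := fun x k => ω (x, k - x, 1)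
  let γ : ℤ → ℤ → Bool := fun x k => ω (x, k - x, 2)
  have eα : ∀ x y, α x (x + y) = ω (x, y, 0) := fun x y => by simp [α]
  have eβ : ∀ x y, β x (x + y) = ω (x, y, 1) := fun x y => by simp [β]
  have eγ : ∀ x y, γ x (x + y) = ω (x, y, 2) := fun x y => by simp [γ]
  have key := fill_bulk M hM Z α β γ (fun x k => hω1 x (k - x))
    (fun x k => by
      have := hω2 x (k + 1 - x)
      have e1 : k + 1 - x = k - (x - 1) := by ring
      have e2 : k + 1 - x - 1 = k - x := by ring
      rw [e2] at this
      simpa only [α, β, γ, e1] using this) hZR hZ1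
    (fun x hx => ((mem_S_true _ _ _).1 (hT x hx)).1)
    (fun x hx => ((mem_S_false _ _ _).1 (hB x hx)).1)
    (fun k hk => by
      have := ((mem_S_true _ _ _).1 (hL k hk)).2.1
      have e : k - (-M - 1) = k + M + 1 := by ring
      simpa only [β, e] using this)
    (fun k hk => by
      have := ((mem_S_false _ _ _).1 (hR k hk)).2.1
      have e : M + 1 - 1 = M := by ring
      simpa only [β, e] using this)
  obtain ⟨k1, k2, k3, k4, k5⟩ := key
  let ω' : Config := fun e => if e.2.2 = 0 then fA M α β e.1 (e.1 + e.2.1)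
    else if e.2.2 = 1 then fB M β e.1 (e.1 + e.2.1) else fC M Z α β γ e.1 (e.1 + e.2.1)
  have e0 : ∀ x y, ω' (x, y, 0) = fA M α β x (x + y) := fun x y => rfl
  have e1 : ∀ x y, ω' (x, y, 1) = fB M β x (x + y) := fun x y => rfl
  have e2 : ∀ x y, ω' (x, y, 2) = fC M Z α β γ x (x + y) := fun x y => rfl
  have g1 : ∀ x y : ℤ, x - 1 + y = x + y - 1 := fun x y => by ring
  have g2 : ∀ x y : ℤ, x + (y - 1) = x + y - 1 := fun x y => by ring
  have g3 : ∀ x y : ℤ, x + y = x + y - 1 + 1 := fun x y => by ring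
  have fAo : ∀ x k, ¬ (-M ≤ x ∧ x ≤ M ∧ -M + 1 ≤ k ∧ k ≤ M) → fA M α β x k = α x k := by
    intro x k h; unfold fA; rw [if_neg h]
  have fBo : ∀ x k, ¬ (-M ≤ x ∧ x ≤ M - 1 ∧ -M ≤ k ∧ k ≤ M) → fB M β x k = β x k := by
    intro x k h; unfold fB; rw [if_neg h]
  have fCo : ∀ x k, ¬ (-M ≤ x ∧ x ≤ M ∧ -M ≤ k ∧ k ≤ M) → fC M Z α β γ x k = γ x k := by
    intro x k h; unfold fC; rw [if_neg h]
  refine ⟨ω', ?_, ?_, ?_, ?_, ?_⟩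
  · rw [isConfig_iff]
    refine ⟨fun x y => by rw [e0, e1, e2]; exact k1 _ _, fun x y => ?_⟩
    rw [e0, e1, e2, g1, g2]
    have := k2 x (x + y - 1)
    rwa [← g3] at this
  · have hsub : {e | ω e ≠ ω' e} ⊆
        ((Finset.Icc (-M) M) ×ˢ ((Finset.Icc (-2*M) (2*M)) ×ˢ (Finset.univ : Finset (Fin 3))) : Finset HexE) := by
      rintro ⟨x, y, i⟩ he
      simp only [Finset.coe_product, Set.mem_prod, Finset.coe_Icc, Set.mem_Icc, Finset.coe_univ, Set.mem_univ, and_true]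
      by_contra hcon
      apply he
      fin_cases i
      · change ω (x, y, 0) = ω' (x, y, 0)
        rw [e0, fAo _ _ (by omega), eα]
      · change ω (x, y, 1) = ω' (x, y, 1)
        rw [e1, fBo _ _ (by omega), eβ]
      · change ω (x, y, 2) = ω' (x, y, 2)
        rw [e2, fCo _ _ (by omega), eγ]
    exact (Finset.finite_toSet _).subset hsub
  · rintro ⟨x, y, t⟩ hv
    cases t
    · simp only [Reg, Set.mem_ofPred_eq, sk_false] at hv
      rw [mem_S_false, mem_S_false, e0, e1, e2, fAo _ _ (by omega), fBo _ _ (by omega), fCo _ _ (by omega),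
        eα, eβ, eγ]
    · simp only [Reg, Set.mem_ofPred_eq, sk_true] at hv
      rw [mem_S_true, mem_S_true, e0, e1, e2, fAo _ _ (by omega), fBo _ _ (by omega), fCo _ _ (by omega),
        eα, eβ, eγ]
  · rintro ⟨x, y, t⟩ hv
    cases t
    · rw [sk_false] at hv
      obtain ⟨-, -, h3, h4, h5⟩ := k3 _ _ hv
      rw [mem_S_false, e0, e1, e2, g1, g2]
      exact ⟨by rw [g3]; exact h4, h5, h3⟩
    · rw [sk_true] at hv
      obtain ⟨h1, h2, h3, -, -⟩ := k3 _ _ hv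
      rw [mem_S_true, e0, e1, e2]
      exact ⟨h1, h2, h3⟩
  · rintro ⟨x, y, t⟩ hv hS hz
    obtain ⟨r1, r2, r3, r4⟩ := hv
    cases t
    · right
      rw [mem_S_false, e0, e1, e2, g1, g2] at hS
      exact ⟨rfl, k5 _ _ r1 r2 r3 r4 hz (by have := hS.1; rw [g3] at this; exact this) hS.2.1 hS.2.2⟩
    · left
      rw [mem_S_true, e0, e1, e2] at hS
      exact ⟨rfl, k4 _ _ r1 r2 r3 r4 hz hS.1 hS.2.1 hS.2.2⟩

/-! ### Finite energy -/

def flipC (D : Finset HexE) (ω : Config) : Config := fun e => if e ∈ D then !ω e else ω e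

lemma flipC_flipC (D : Finset HexE) (ω : Config) : flipC D (flipC D ω) = ω := by
  funext e
  unfold flipC
  split_ifs <;> simp

lemma weight_bounds (a b c : ℝ) (f : Fin 3 → Bool) (hf : nae (f 0) (f 1) (f 2)) :
    min a (min b c) ≤ weight a b c f ∧ weight a b c f ≤ max a (max b c) := by
  unfold weight
  revert hf
  generalize f 0 = p
  generalize f 1 = q
  generalize f 2 = r
  cases p <;> cases q <;> cases r <;> simp [nae]

lemma edgeNbhd_finite (F : Finset HexE) : (edgeNbhd F).Finite := by
  have : edgeNbhd F ⊆ ⋃ e ∈ F, ((Finset.Icc (e.1 - 1) (e.1 + 1) ×ˢ (Finset.Icc (e.2.1 - 1) (e.2.1 + 1) ×ˢ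
      (Finset.univ : Finset (Fin 3))) : Finset HexE) : Set HexE) := by
    rintro ⟨x', y', i'⟩ ⟨⟨x, y, i⟩, he, h⟩
    simp only [Set.mem_iUnion]
    refine ⟨(x, y, i), he, ?_⟩
    simp only [Finset.coe_product, Set.mem_prod, Finset.coe_Icc, Set.mem_Icc, Finset.coe_univ, Set.mem_univ, and_true]
    unfold end1 end2 at h
    simp only at h
    split_ifs at h <;> simp only [Prod.mk.injEq] at h <;> simp at h <;> omega
  exact Set.Finite.subset (Set.Finite.biUnion (Finset.finite_toSet F) (fun e _ => Finset.finite_toSet _)) this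

lemma mem_verts_of (D : Finset HexE) (v : HexV) (i : Fin 3) (h : edgesAt v i ∈ D) : v ∈ verts D := by
  unfold verts
  rw [Finset.mem_biUnion]
  refine ⟨_, h, ?_⟩
  obtain ⟨x, y, t⟩ := v
  unfold endsFinset edgesAt end1 end2
  cases t <;> fin_cases i <;> simp

lemma gibbs_ratio {a b c : ℝ} (ha : 0 < a) (hb : 0 < b) (hc : 0 < c) {μ : Measure Config}
    (hG : IsGibbs a b c μ) (D F : Finset HexE) (hDF : D ⊆ F) (σ : Config) (hσ : IsConfig σ)
    (hτ : IsConfig (flipC D σ)) :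
    μ (cyl (↑F ∪ edgeNbhd F) σ) ≤
      ENNReal.ofReal ((max a (max b c)) ^ (verts D).card / (min a (min b c)) ^ (verts D).card) *
      μ (cyl (↑F ∪ edgeNbhd F) (flipC D σ)) := by
  set τ := flipC D σ with hτd
  set m := min a (min b c) with hm
  set X := max a (max b c) with hX
  have hm0 : 0 < m := by simp [hm, ha, hb, hc]
  have hw : ∀ ρ, IsConfig ρ → ∀ v, m ≤ weight a b c (localConf ρ v) ∧ weight a b c (localConf ρ v) ≤ X :=
    fun ρ hρ v => weight_bounds a b c _ ((nae_iff _).1 (hρ v))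
  have hg := hG.2.2 F σ τ hσ hτ (by
    intro e he
    have : e ∉ D := fun h => he (hDF h)
    simp [hτd, flipC, this])
  have hsub : verts D ⊆ verts F := Finset.biUnion_subset_biUnion_of_subset_left _ hDF
  have heq : ∀ v ∈ verts F \ verts D, weight a b c (localConf τ v) = weight a b c (localConf σ v) := by
    intro v hv
    have hv' := (Finset.mem_sdiff.1 hv).2
    congr 1
    funext i
    have : edgesAt v i ∉ D := fun h => hv' (mem_verts_of D v i h)
    simp [localConf, hτd, flipC, this]
  rw [← Finset.prod_sdiff hsub, ← Finset.prod_sdiff hsub, Finset.prod_congr rfl heq] at hg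
  set P := ∏ v ∈ verts F \ verts D, weight a b c (localConf σ v) with hP
  set wτ := ∏ v ∈ verts D, weight a b c (localConf τ v) with hwτ
  set wσ := ∏ v ∈ verts D, weight a b c (localConf σ v) with hwσ
  have hP0 : 0 < P := Finset.prod_pos (fun v _ => lt_of_lt_of_le hm0 (hw σ hσ v).1)
  have h1 : m ^ (verts D).card ≤ wτ := by
    rw [← Finset.prod_const]
    exact Finset.prod_le_prod (fun _ _ => hm0.le) (fun v _ => (hw τ hτ v).1)
  have h2 : wσ ≤ X ^ (verts D).card := by
    rw [← Finset.prod_const]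
    exact Finset.prod_le_prod (fun v _ => hm0.le.trans (hw σ hσ v).1) (fun v _ => (hw σ hσ v).2)
  have hmn : 0 < m ^ (verts D).card := by positivity
  have hwτ0 : 0 < wτ := lt_of_lt_of_le hmn h1
  set A := μ (cyl (↑F ∪ edgeNbhd F) σ)
  set B := μ (cyl (↑F ∪ edgeNbhd F) τ)
  have hA : A = B * ENNReal.ofReal (wσ / wτ) := by
    have hne : ENNReal.ofReal (P * wτ) ≠ 0 := by
      simp only [ne_eq, ENNReal.ofReal_eq_zero, not_le]; positivity
    have := congrArg (· / ENNReal.ofReal (P * wτ)) hg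
    rw [ENNReal.mul_div_cancel_right hne ENNReal.ofReal_ne_top, mul_div_assoc,
      ← ENNReal.ofReal_div_of_pos (by positivity)] at this
    rw [this]
    congr 2
    field_simp
  rw [hA, mul_comm]
  gcongr

noncomputable def G0 (D : Finset HexE) (n : ℕ) : Finset HexE :=
  D ∪ (Finset.Icc (-(n:ℤ)) n ×ˢ (Finset.Icc (-(n:ℤ)) n ×ˢ (Finset.univ : Finset (Fin 3))))

lemma G0_mono (D : Finset HexE) : Monotone (G0 D) := by
  intro m n h e
  unfold G0
  simp only [Finset.mem_union, Finset.mem_product, Finset.mem_Icc, Finset.mem_univ, and_true]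
  have hc : (m:ℤ) ≤ n := by exact_mod_cast h
  rintro (h1 | h1)
  · exact Or.inl h1
  · right; omega

lemma G0_exh (D F : Finset HexE) : ∃ n, F ⊆ G0 D n := by
  refine ⟨F.sup (fun e => e.1.natAbs + e.2.1.natAbs), fun e he => ?_⟩
  have : e.1.natAbs + e.2.1.natAbs ≤ F.sup (fun e => e.1.natAbs + e.2.1.natAbs) :=
    Finset.le_sup (f := fun e : HexE => e.1.natAbs + e.2.1.natAbs) he
  unfold G0
  simp only [Finset.mem_union, Finset.mem_product, Finset.mem_Icc, Finset.mem_univ, and_true]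
  omega

lemma measurableSet_cyl {T : Set HexE} (σ : Config) : MeasurableSet (cyl T σ) := by
  have : cyl T σ = ⋂ e ∈ T, (fun ω : Config => ω e) ⁻¹' {σ e} := by
    ext ω; simp [cyl]
  rw [this]
  exact MeasurableSet.biInter (Set.to_countable _)
    (fun e _ => (measurable_pi_apply e) (MeasurableSet.of_discrete))

lemma open_cyl {O : Set Config} (hO : IsOpen O) {ω : Config} (h : ω ∈ O) :
    ∃ F : Finset HexE, cyl ↑F ω ⊆ O := by
  obtain ⟨F, u, hu, hsub⟩ := isOpen_pi_iff.1 hO ω h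
  refine ⟨F, fun ω' hω' => hsub ?_⟩
  intro e he
  rw [hω' e he]
  exact (hu e he).2

lemma flip_null {a b c : ℝ} (ha : 0 < a) (hb : 0 < b) (hc : 0 < c) {μ : Measure Config}
    (hG : IsGibbs a b c μ) (D : Finset HexE) (B : Set Config) (hB : μ B = 0) :
    μ {ω | (IsConfig ω ∧ IsConfig (flipC D ω)) ∧ flipC D ω ∈ B} = 0 := by
  have hprob := hG.1
  set κ := (max a (max b c)) ^ (verts D).card / (min a (min b c)) ^ (verts D).card with hκ
  have hκ0 : 0 < κ := by
    have h1 : 0 < max a (max b c) := by simp [ha]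
    have h2 : 0 < min a (min b c) := by simp [ha, hb, hc]
    positivity
  set K := ENNReal.ofReal κ with hK
  let A : Set Config := {ω | IsConfig ω ∧ IsConfig (flipC D ω)}
  have main : ∀ O : Set Config, IsOpen O → μ (A ∩ flipC D ⁻¹' O) ≤ K * μ O := by
    intro O hO
    let T : ℕ → Set HexE := fun n => ↑(G0 D n) ∪ edgeNbhd (G0 D n)
    let On : ℕ → Set Config := fun n => {ω | cyl (T n) ω ⊆ O}
    have hTmono : Monotone T := by
      intro m n h
      refine Set.union_subset_union (by exact_mod_cast G0_mono D h) ?_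
      rintro e ⟨e', he', h'⟩
      exact ⟨e', G0_mono D h he', h'⟩
    have hOmono : Monotone On := by
      intro m n h ω hω
      exact fun ω' hω' => hω (fun e he => hω' e (hTmono h he))
    have hOU : O = ⋃ n, On n := by
      ext ω
      rw [Set.mem_iUnion]
      constructor
      · intro h
        obtain ⟨F, hF⟩ := open_cyl hO h
        obtain ⟨n, hn⟩ := G0_exh D F
        refine ⟨n, fun ω' hω' => hF (fun e he => hω' e (Or.inl (hn he)))⟩
      · rintro ⟨n, hn⟩
        exact hn (fun e _ => rfl)
    have step : ∀ n, μ (A ∩ flipC D ⁻¹' (On n)) ≤ K * μ (On n) := by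
      intro n
      have hfin : (T n).Finite := (Finset.finite_toSet _).union (edgeNbhd_finite _)
      haveI : Finite (T n) := hfin
      let pat : ((T n) → Bool) → Set Config := fun g => {ω | ∀ e : T n, ω e = g e}
      have hpat : ∀ g, ∀ ω ∈ pat g, pat g = cyl (T n) ω := by
        intro g ω hω
        ext ω'
        constructor
        · intro h e he
          rw [h ⟨e, he⟩, hω ⟨e, he⟩]
        · intro h e
          rw [h e.1 e.2, hω e]
      have hmem : ∀ g ω, ω ∈ pat g → ω ∈ On n → pat g ⊆ On n := by
        intro g ω h1 h2 ω' h3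
        change cyl (T n) ω' ⊆ O
        rw [← hpat g ω' h3, hpat g ω h1]
        exact h2
      have hdec : On n = ⋃ g, On n ∩ pat g := by
        ext ω
        simp only [Set.mem_iUnion]
        exact ⟨fun h => ⟨fun e => ω e, h, fun e => rfl⟩, fun ⟨g, h, _⟩ => h⟩
      have hmeas : ∀ g, MeasurableSet (On n ∩ pat g) := by
        intro g
        by_cases hne : (On n ∩ pat g).Nonempty
        · obtain ⟨ω, h1, h2⟩ := hne
          rw [Set.inter_eq_right.2 (hmem g ω h2 h1), hpat g ω h2]
          exact measurableSet_cyl ω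
        · rw [Set.not_nonempty_iff_eq_empty.1 hne]; exact MeasurableSet.empty
      have hdisj : Pairwise (Function.onFun Disjoint fun g => On n ∩ pat g) := by
        intro g g' hgg
        rw [Function.onFun, Set.disjoint_left]
        rintro ω ⟨-, h1⟩ ⟨-, h2⟩
        exact hgg (funext fun e => by rw [← h1 e, h2 e])
      have e1 : μ (On n) = ∑' g, μ (On n ∩ pat g) := by
        conv_lhs => rw [hdec]
        exact measure_iUnion hdisj hmeas
      have e2 : A ∩ flipC D ⁻¹' (On n) ⊆ ⋃ g, A ∩ flipC D ⁻¹' (On n ∩ pat g) := by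
        rintro ω ⟨h1, h2⟩
        rw [Set.mem_iUnion]
        exact ⟨fun e => flipC D ω e, h1, h2, fun e => rfl⟩
      calc μ (A ∩ flipC D ⁻¹' (On n)) ≤ ∑' g, μ (A ∩ flipC D ⁻¹' (On n ∩ pat g)) :=
            (measure_mono e2).trans (measure_iUnion_le _)
        _ ≤ ∑' g, K * μ (On n ∩ pat g) := by
            refine ENNReal.tsum_le_tsum fun g => ?_
            by_cases hne : (A ∩ flipC D ⁻¹' (On n ∩ pat g)).Nonempty
            · obtain ⟨ω, h1, h2, h3⟩ := hne
              have h4 : A ∩ flipC D ⁻¹' (On n ∩ pat g) ⊆ cyl (T n) ω := by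
                rintro ω' ⟨-, -, h5⟩ e he
                have h6 := h5 ⟨e, he⟩
                have h7 := h3 ⟨e, he⟩
                rw [← h7] at h6
                simp only [flipC] at h6
                split_ifs at h6 <;> simpa using h6
              have h5 : cyl (T n) (flipC D ω) ⊆ On n ∩ pat g := by
                rw [Set.inter_eq_right.2 (hmem g _ h3 h2), hpat g _ h3]
              calc _ ≤ μ (cyl (T n) ω) := measure_mono h4
                _ ≤ K * μ (cyl (T n) (flipC D ω)) :=
                    gibbs_ratio ha hb hc hG D (G0 D n) Finset.subset_union_left ω h1.1 h1.2
                _ ≤ _ := by gcongr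
            · rw [Set.not_nonempty_iff_eq_empty.1 hne]; simp
        _ = K * μ (On n) := by rw [ENNReal.tsum_mul_left, e1]
    have : A ∩ flipC D ⁻¹' O = ⋃ n, A ∩ flipC D ⁻¹' (On n) := by
      conv_lhs => rw [hOU]
      rw [Set.preimage_iUnion, Set.inter_iUnion]
    rw [this, Monotone.measure_iUnion]
    · refine iSup_le fun n => (step n).trans ?_
      gcongr
      rw [hOU]; exact Set.subset_iUnion _ n
    · intro m n h
      exact Set.inter_subset_inter_right _ (Set.preimage_mono (hOmono h))
  have hle : ∀ ε : ENNReal, 0 < ε → μ (A ∩ flipC D ⁻¹' B) ≤ K * ε := by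
    intro ε hε
    obtain ⟨O, hBO, hO, hlt⟩ := Set.exists_isOpen_lt_of_lt (μ := μ) B ε (by rw [hB]; exact hε)
    calc _ ≤ μ (A ∩ flipC D ⁻¹' O) :=
          measure_mono (Set.inter_subset_inter_right _ (Set.preimage_mono hBO))
      _ ≤ K * μ O := main O hO
      _ ≤ _ := by gcongr
  have hK0 : K ≠ 0 := by simp [hK, hκ0]
  have hKt : K ≠ ⊤ := ENNReal.ofReal_ne_top
  change μ (A ∩ flipC D ⁻¹' B) = 0
  by_contra hne
  have hpos : 0 < μ (A ∩ flipC D ⁻¹' B) := pos_iff_ne_zero.2 hne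
  obtain ⟨ε, hε0, hε⟩ := exists_between hpos
  have h := hle (ε / K) (ENNReal.div_pos hε0.ne' hKt)
  rw [ENNReal.mul_div_cancel hK0 hKt] at h
  exact absurd hε (not_lt.2 h)

lemma finite_energy {a b c : ℝ} (ha : 0 < a) (hb : 0 < b) (hc : 0 < c) {μ : Measure Config}
    (hG : IsGibbs a b c μ) (B : Set Config) (hB : μ B = 0) :
    μ {ω | IsConfig ω ∧ ∃ ω' ∈ B, IsConfig ω' ∧ {e | ω e ≠ ω' e}.Finite} = 0 := by
  refine measure_mono_null ?_ (measure_iUnion_null (fun D => flip_null ha hb hc hG D B hB))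
  rintro ω ⟨h1, ω', h2, h3, h4⟩
  rw [Set.mem_iUnion]
  have : flipC h4.toFinset ω = ω' := by
    funext e
    simp only [flipC, Set.Finite.mem_toFinset, Set.mem_ofPred_eq]
    split_ifs with h
    · revert h; cases ω e <;> cases ω' e <;> simp
    · simpa using h
  refine ⟨h4.toFinset, ⟨h1, ?_⟩, ?_⟩
  · rw [this]; exact h3
  · rw [this]; exact h2

lemma measurableSet_isConfig : MeasurableSet {ω : Config | IsConfig ω} := by
  have : {ω : Config | IsConfig ω} = ⋂ v : HexV, (fun ω : Config => localConf ω v) ⁻¹'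
      {f | nae (f 0) (f 1) (f 2)} := by
    ext ω
    simp only [Set.mem_ofPred_eq, Set.mem_iInter, Set.mem_preimage]
    unfold IsConfig
    simp only [nae_iff]
  rw [this]
  refine MeasurableSet.iInter fun v => ?_
  have hm : Measurable (fun ω : Config => localConf ω v) :=
    measurable_pi_lambda _ (fun i => measurable_pi_apply _)
  exact hm (Set.toFinite _).measurableSet

/-! ### Components -/

lemma hexAdj_iff (x y : ℤ) (t : Bool) (x' y' : ℤ) (t' : Bool) : HexAdj (x, y, t) (x', y', t') ↔
    (t = true ∧ t' = false ∧ ((x' = x ∧ y' = y) ∨ (x' = x + 1 ∧ y' = y) ∨ (x' = x ∧ y' = y + 1))) ∨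
    (t = false ∧ t' = true ∧ ((x' = x ∧ y' = y) ∨ (x' = x - 1 ∧ y' = y) ∨ (x' = x ∧ y' = y - 1))) := by
  unfold HexAdj
  constructor
  · rintro ⟨hne, ⟨a, b, i⟩, h1, h2⟩
    fin_cases i <;> simp [end1, end2] at h1 h2 hne <;> cases t <;> cases t' <;> simp at h1 h2 hne ⊢ <;> omega
  · rintro (⟨rfl, rfl, h⟩ | ⟨rfl, rfl, h⟩)
    · refine ⟨by simp, ?_⟩
      rcases h with h | h | h
      · exact ⟨(x, y, 0), by simp [end1, end2, h]⟩
      · exact ⟨(x, y, 1), by simp [end1, end2, h]⟩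
      · exact ⟨(x, y, 2), by simp [end1, end2, h]⟩
    · refine ⟨by simp, ?_⟩
      rcases h with h | h | h
      · exact ⟨(x, y, 0), by simp [end1, end2, h]⟩
      · exact ⟨(x-1, y, 1), by simp [end1, end2, h]⟩
      · exact ⟨(x, y-1, 2), by simp [end1, end2, h]⟩

lemma hexAdj_symm {v w : HexV} (h : HexAdj v w) : HexAdj w v := by
  obtain ⟨h1, e, h2, h3⟩ := h
  exact ⟨h1.symm, e, h3, h2⟩

lemma adjIn_symm {S : Set HexV} {v w : HexV} (h : adjIn S v w) : adjIn S w v :=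
  ⟨hexAdj_symm h.1, h.2.2, h.2.1⟩

lemma compOf_self (S : Set HexV) (v : HexV) : v ∈ compOf S v := Relation.ReflTransGen.refl

lemma compOf_symm {S : Set HexV} {v w : HexV} (h : w ∈ compOf S v) : v ∈ compOf S w := by
  unfold compOf at *
  simp only [Set.mem_ofPred_eq] at *
  induction h with
  | refl => exact Relation.ReflTransGen.refl
  | tail _ h2 ih => exact Relation.ReflTransGen.head (adjIn_symm h2) ih

lemma compOf_trans {S : Set HexV} {u v w : HexV} (h : v ∈ compOf S u) (h' : w ∈ compOf S v) :
    w ∈ compOf S u := Relation.ReflTransGen.trans h h'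

lemma compOf_eq {S : Set HexV} {v w : HexV} (h : w ∈ compOf S v) : compOf S w = compOf S v := by
  ext u
  exact ⟨fun h' => compOf_trans h h', fun h' => compOf_trans (compOf_symm h) h'⟩

lemma compOf_adj {S : Set HexV} {v u w : HexV} (h : u ∈ compOf S v) (h' : adjIn S u w) :
    w ∈ compOf S v := Relation.ReflTransGen.tail h h'

lemma compOf_closed {S W : Set HexV} {v : HexV} (hv : v ∈ W)
    (hW : ∀ a b, a ∈ W → adjIn S a b → b ∈ W) : compOf S v ⊆ W := by
  intro w hw
  induction hw with
  | refl => exact hv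
  | tail _ h2 ih => exact hW _ _ ih h2

lemma compOf_mono {S T : Set HexV} (h : S ⊆ T) (v : HexV) : compOf S v ⊆ compOf T v := by
  intro w hw
  exact compOf_closed (W := compOf T v) (compOf_self _ _) (fun a b ha hab => compOf_adj ha ⟨hab.1, h hab.2.1, h hab.2.2⟩) hw

lemma compOf_subset {S : Set HexV} {v : HexV} (h : v ∈ S) : compOf S v ⊆ S := by
  intro w hw
  induction hw with
  | refl => exact h
  | tail _ h2 _ => exact h2.2.2

lemma conn_ind {X A : Set HexV} {v : HexV} (f : HexV → ℕ)
    (h : ∀ w ∈ A, w = v ∨ ∃ w', (w' = v ∨ w' ∈ A) ∧ adjIn X w' w ∧ f w' < f w) :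
    A ⊆ compOf X v := by
  have : ∀ n, ∀ w ∈ A, f w < n → w ∈ compOf X v := by
    intro n
    induction n with
    | zero => intro w _ h; omega
    | succ n ih =>
      intro w hw hf
      rcases h w hw with rfl | ⟨w', hw', hadj, hlt⟩
      · exact compOf_self _ _
      · refine compOf_adj ?_ hadj
        rcases hw' with rfl | hw'
        · exact compOf_self _ _
        · exact ih w' hw' (by omega)
  exact fun w hw => this _ w hw (Nat.lt_succ_self _)

def SetEnc (S B1 B3 : Set HexV) : Prop :=
  ∃ C, IsCompOf S C ∧ C.Infinite ∧ B1 ⊆ C ∧ (∀ D, IsCompOf (C \ B3) D → D.Infinite) ∧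
    {D : Set HexV | IsCompOf (C \ B3) D ∧ D.Infinite}.encard = 3

lemma enc_abs (S B1 B3 : Set HexV) (o : HexV) (v : Fin 3 → HexV) (ho : o ∈ S ∩ B3)
    (ha : B1 ⊆ compOf S o)
    (hb : ∀ u ∈ S ∩ B3, ∀ w ∈ S \ B3, HexAdj u w → ∃ i, w ∈ compOf (S \ B3) (v i))
    (hc : ∀ i, v i ∈ S \ B3) (hc' : ∀ i, v i ∈ compOf S o)
    (hd : ∀ i, (compOf (S \ B3) (v i)).Infinite)
    (he : ∀ i j, i ≠ j → v j ∉ compOf (S \ B3) (v i)) : SetEnc S B1 B3 := by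
  set C := compOf S o with hC
  have hCS : C ⊆ S := compOf_subset ho.1
  have hcomp : ∀ w ∈ C, compOf (C \ B3) w = compOf (S \ B3) w := by
    intro w hw
    apply Set.Subset.antisymm (compOf_mono (Set.sdiff_subset_sdiff_left hCS) w)
    intro u hu
    have : u ∈ {u | u ∈ compOf (C \ B3) w ∧ u ∈ C} := by
      refine compOf_closed (W := {u | u ∈ compOf (C \ B3) w ∧ u ∈ C}) (S := S \ B3) ⟨compOf_self _ _, hw⟩ ?_ hu
      rintro a b ⟨h1, h2⟩ h3
      have hbC : b ∈ C := compOf_adj h2 ⟨h3.1, h3.2.1.1, h3.2.2.1⟩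
      exact ⟨compOf_adj h1 ⟨h3.1, ⟨h2, h3.2.1.2⟩, ⟨hbC, h3.2.2.2⟩⟩, hbC⟩
    exact this.1
  have hall : ∀ w ∈ C \ B3, ∃ i, w ∈ compOf (S \ B3) (v i) := by
    rintro w ⟨hw, hwB⟩
    have hw' := compOf_symm hw
    revert hwB
    refine Relation.ReflTransGen.head_induction_on (motive := fun w _ => w ∉ B3 → ∃ i, w ∈ compOf (S \ B3) (v i)) hw' ?_ ?_
    · intro h; exact absurd ho.2 h
    · intro a c hac _ ih haB
      by_cases hcB : c ∈ B3
      · exact hb c ⟨hac.2.2, hcB⟩ a ⟨hac.2.1, haB⟩ (hexAdj_symm hac.1)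
      · obtain ⟨i, hi⟩ := ih hcB
        exact ⟨i, compOf_adj hi ⟨hexAdj_symm hac.1, ⟨hac.2.2, hcB⟩, ⟨hac.2.1, haB⟩⟩⟩
  have hcl : ∀ D, IsCompOf (C \ B3) D ↔ ∃ i, D = compOf (S \ B3) (v i) := by
    intro D
    constructor
    · rintro ⟨w, hw, rfl⟩
      obtain ⟨i, hi⟩ := hall w hw
      exact ⟨i, by rw [hcomp w hw.1, compOf_eq hi]⟩
    · rintro ⟨i, rfl⟩
      exact ⟨v i, ⟨hc' i, (hc i).2⟩, by rw [hcomp _ (hc' i)]⟩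
  refine ⟨C, ⟨o, ho.1, rfl⟩, ?_, ha, ?_, ?_⟩
  · refine (hd 0).mono ?_
    rw [hC, ← compOf_eq (hc' 0)]
    exact compOf_mono Set.sdiff_subset _
  · intro D hD
    obtain ⟨i, rfl⟩ := (hcl D).1 hD
    exact hd i
  · have : {D : Set HexV | IsCompOf (C \ B3) D ∧ D.Infinite} =
        Set.range (fun i => compOf (S \ B3) (v i)) := by
      ext D
      simp only [Set.mem_ofPred_eq, Set.mem_range, hcl]
      constructor
      · rintro ⟨⟨i, rfl⟩, _⟩; exact ⟨i, rfl⟩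
      · rintro ⟨i, rfl⟩; exact ⟨⟨i, rfl⟩, hd i⟩
    rw [this]
    have hinj : Function.Injective (fun i => compOf (S \ B3) (v i)) := by
      intro i j hij
      by_contra hne
      apply he i j hne
      have : compOf (S \ B3) (v i) = compOf (S \ B3) (v j) := hij
      rw [this]; exact compOf_self _ _
    rw [← Set.image_univ, hinj.encard_image]
    simp

/-! ### Transport along automorphisms -/

lemma compOf_preimage (φ : HexV ≃ HexV) (hφ : ∀ v w, HexAdj (φ v) (φ w) ↔ HexAdj v w)
    (S : Set HexV) (v : HexV) : compOf (φ ⁻¹' S) v = φ ⁻¹' (compOf S (φ v)) := by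
  ext w
  constructor
  · intro h
    exact compOf_closed (W := φ ⁻¹' (compOf S (φ v))) (compOf_self _ _) (fun a b ha hab =>
      compOf_adj ha ⟨(hφ _ _).2 hab.1, hab.2.1, hab.2.2⟩) h
  · intro h
    have : φ w ∈ φ.symm ⁻¹' (compOf (φ ⁻¹' S) v) := by
      refine compOf_closed (S := S) (v := φ v) ?_ ?_ h
      · simpa using compOf_self _ _
      · intro a b ha hab
        exact compOf_adj (u := φ.symm a) ha ⟨(hφ _ _).1 (by simpa using hab.1),
          by simpa using hab.2.1, by simpa using hab.2.2⟩
    simpa using this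

lemma isCompOf_preimage (φ : HexV ≃ HexV) (hφ : ∀ v w, HexAdj (φ v) (φ w) ↔ HexAdj v w)
    (S D : Set HexV) : IsCompOf (φ ⁻¹' S) (φ ⁻¹' D) ↔ IsCompOf S D := by
  constructor
  · rintro ⟨v, hv, h⟩
    refine ⟨φ v, hv, ?_⟩
    rw [compOf_preimage φ hφ] at h
    exact φ.surjective.preimage_injective h
  · rintro ⟨v, hv, rfl⟩
    refine ⟨φ.symm v, by simpa using hv, ?_⟩
    rw [compOf_preimage φ hφ]; simp

lemma infinite_preimage (φ : HexV ≃ HexV) (D : Set HexV) : (φ ⁻¹' D).Infinite ↔ D.Infinite := by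
  rw [← Equiv.image_symm_eq_preimage]
  exact Set.infinite_image_iff φ.symm.injective.injOn

lemma setEnc_preimage (φ : HexV ≃ HexV) (hφ : ∀ v w, HexAdj (φ v) (φ w) ↔ HexAdj v w)
    (S B1 B3 : Set HexV) (h : SetEnc (φ ⁻¹' S) (φ ⁻¹' B1) (φ ⁻¹' B3)) : SetEnc S B1 B3 := by
  obtain ⟨C', h1, h2, h3, h4, h5⟩ := h
  obtain ⟨C, rfl⟩ : ∃ C, C' = φ ⁻¹' C := ⟨φ.symm ⁻¹' C', by ext; simp⟩
  refine ⟨C, (isCompOf_preimage φ hφ _ _).1 h1, (infinite_preimage _ _).1 h2,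
    (Set.preimage_subset_preimage_iff (by rw [φ.surjective.range_eq]; exact Set.subset_univ _)).1 h3, ?_, ?_⟩
  · intro D hD
    rw [← infinite_preimage φ]
    exact h4 _ ((isCompOf_preimage φ hφ _ _).2 hD)
  · rw [← h5, ← (φ.surjective.preimage_injective.injOn (s := {D : Set HexV | IsCompOf (C \ B3) D ∧ D.Infinite})).encard_image]
    congr 1
    ext D'
    constructor
    · rintro ⟨D, ⟨hD1, hD2⟩, rfl⟩
      exact ⟨(isCompOf_preimage φ hφ _ _).2 hD1, (infinite_preimage _ _).2 hD2⟩
    · rintro ⟨hD1, hD2⟩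
      obtain ⟨D, rfl⟩ : ∃ D, D' = φ ⁻¹' D := ⟨φ.symm ⁻¹' D', by ext; simp⟩
      exact ⟨D, ⟨(isCompOf_preimage φ hφ _ _).1 hD1, (infinite_preimage _ _).1 hD2⟩, rfl⟩

/-! ### Geometry of the tripod in centred coordinates -/

def bx (s : Bool) (n : ℤ) : Set HexV :=
  {v | (s = true → -n ≤ v.1 ∧ v.1 ≤ n) ∧ (s = false → -n ≤ v.2.1 ∧ v.2.1 ≤ n) ∧
    (v.2.2 = true → -n ≤ v.1 + v.2.1 ∧ v.1 + v.2.1 ≤ n) ∧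
    (v.2.2 = false → -n ≤ v.1 + v.2.1 - 1 ∧ v.1 + v.2.1 - 1 ≤ n)}

def arm (P1 P3 : ℤ) (i : Fin 3) (p q : ℤ) : Prop :=
  (i = 0 ∧ ((p = P1 ∧ -15 ≤ q ∧ q ≤ 0) ∨ (q = 0 ∧ P1 ≤ p ∧ p < 0))) ∨
  (i = 1 ∧ (p = 0 ∧ -15 ≤ q ∧ q < 0)) ∨
  (i = 2 ∧ ((p = P3 ∧ -15 ≤ q ∧ q ≤ 0) ∨ (q = 0 ∧ 0 < p ∧ p ≤ P3)))

def boxSite (s : Bool) (p q : ℤ) : Prop :=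
  (s = true → -1 ≤ p ∧ p ≤ 1) ∧ (s = false → -1 ≤ q ∧ q ≤ 1) ∧ -1 ≤ p + q ∧ p + q ≤ 2

def ZZ (s : Bool) (P1 P3 p q : ℤ) : Prop := boxSite s p q ∨ ∃ i, arm P1 P3 i p q

def Pv (P1 P3 : ℤ) (i : Fin 3) : ℤ := if i = 0 then P1 else if i = 1 then 0 else P3

lemma arm_adj {P1 P3 : ℤ} (h1 : P1 ≤ -15) (h3 : 15 ≤ P3) {i j : Fin 3} {p q p' q' : ℤ}
    (ha : arm P1 P3 i p q) (hb : arm P1 P3 j p' q')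
    (hd : |p - p'| + |q - q'| ≤ 2) : i = j ∨ (-1 ≤ p ∧ p ≤ 1 ∧ -1 ≤ q ∧ |p - p'| + |q - q'| = 2) := by
  simp only [abs_eq_max_neg] at *
  unfold arm at ha hb
  rcases ha with ⟨rfl, ha⟩ | ⟨rfl, ha⟩ | ⟨rfl, ha⟩ <;> rcases hb with ⟨rfl, hb⟩ | ⟨rfl, hb⟩ | ⟨rfl, hb⟩ <;>
    first | (left; rfl) | (right; omega)

lemma arm_bounds {P1 P3 : ℤ} (h1 : P1 ≤ -15) (h3 : 15 ≤ P3) {i : Fin 3} {p q : ℤ}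
    (ha : arm P1 P3 i p q) : P1 ≤ p ∧ p ≤ P3 ∧ -15 ≤ q ∧ q ≤ 0 ∧ (q = -15 → p = Pv P1 P3 i) := by
  unfold arm at ha
  rcases ha with ⟨rfl, ha⟩ | ⟨rfl, ha⟩ | ⟨rfl, ha⟩ <;> simp [Pv] <;> omega

lemma arm_end {P1 P3 : ℤ} (i : Fin 3) : arm P1 P3 i (Pv P1 P3 i) (-15) := by
  unfold arm Pv
  fin_cases i <;> simp

lemma boxSite_bounds {s : Bool} {p q : ℤ} (h : boxSite s p q) : -3 ≤ p ∧ p ≤ 3 ∧ -3 ≤ q ∧ q ≤ 3 := by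
  unfold boxSite at h
  cases s <;> simp at h <;> omega

lemma boxSite_bx {s : Bool} {p q : ℤ} (h : boxSite s p q) (t : Bool) : ((p, q, t) : HexV) ∈ bx s 3 := by
  unfold boxSite at h
  unfold bx
  cases s <;> cases t <;> simp at h ⊢ <;> omega

lemma bx_boxSite {s : Bool} {p q : ℤ} {t : Bool} (h : ((p, q, t) : HexV) ∈ bx s 1) : boxSite s p q := by
  unfold boxSite
  unfold bx at h
  cases s <;> cases t <;> simp at h ⊢ <;> omega

lemma bx_bounds {s : Bool} {p q : ℤ} {t : Bool} (h : ((p, q, t) : HexV) ∈ bx s 3) :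
    -7 ≤ p ∧ p ≤ 7 ∧ -7 ≤ q ∧ q ≤ 7 := by
  unfold bx at h
  cases s <;> cases t <;> simp at h ⊢ <;> omega

lemma hexAdj_dist {x y x' y' : ℤ} {t t' : Bool} (h : HexAdj (x, y, t) (x', y', t')) :
    |x - x'| + |y - y'| ≤ 1 := by
  rw [hexAdj_iff] at h
  simp only [abs_eq_max_neg]
  omega

/-- outward connectivity along an arm, avoiding the big box -/
lemma arm_conn {P1 P3 : ℤ} (h1 : P1 ≤ -15) (h3 : 15 ≤ P3) (s : Bool) (i : Fin 3) (S : Set HexV)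
    (hv : ((Pv P1 P3 i, -16, true) : HexV) ∈ S)
    (hZ : ∀ p q t, arm P1 P3 i p q → ((p, q, t) : HexV) ∈ S) (p q : ℤ) (t : Bool)
    (ha : arm P1 P3 i p q) (hb : ((p, q, t) : HexV) ∉ bx s 3) :
    ((p, q, t) : HexV) ∈ compOf (S \ bx s 3) (Pv P1 P3 i, -16, true) := by
  have hvb : ((Pv P1 P3 i, -16, true) : HexV) ∉ bx s 3 := fun h => by
    have := bx_bounds h; omega
  let A : Set HexV := {v | arm P1 P3 i v.1 v.2.1 ∧ v ∉ bx s 3}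
  let dist : ℤ → ℤ := fun p => if i = 0 then p - P1 else if i = 1 then 0 else P3 - p
  let f : HexV → ℕ := fun v => (2 * (v.2.1 + 30 + dist v.1) +
    (if v.2.2 = true then (if i = 2 ∧ v.1 < P3 then 0 else 1) else
      (if i = 2 ∧ v.1 < P3 then 1 else 0))).toNat
  refine conn_ind (A := A) f ?_ (show ((p, q, t) : HexV) ∈ A from ⟨ha, hb⟩)
  clear ha hb p q t
  rintro ⟨p, q, t⟩ ⟨ha, hb⟩
  right
  have key : ∃ p' q' t', (arm P1 P3 i p' q' ∨ (p' = Pv P1 P3 i ∧ q' = -16 ∧ t' = true)) ∧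
      ((p', q', t') : HexV) ∉ bx s 3 ∧ HexAdj (p', q', t') (p, q, t) ∧
      f (p', q', t') < f (p, q, t) := by
    simp only at ha
    by_cases hq : q = -15 ∧ t = false
    · obtain ⟨rfl, rfl⟩ := hq
      have hp := (arm_bounds h1 h3 ha).2.2.2.2 rfl
      refine ⟨p, -16, true, Or.inr ⟨hp, rfl, rfl⟩, by rw [hp]; exact hvb, by rw [hexAdj_iff]; simp, ?_⟩
      have : dist p = dist p := rfl
      simp only [f]
      have hd : 0 ≤ dist p := by
        have := arm_bounds h1 h3 ha
        simp only [dist]; split_ifs <;> omega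
      simp
      by_cases hi : i = 2
      · subst hi; simp [Pv] at hp; simp [hp]; simp [dist, hp]
      · simp [hi]; omega
    · unfold arm at ha
      rcases ha with ⟨rfl, ha⟩ | ⟨rfl, ha⟩ | ⟨rfl, ha⟩
      · cases t
        · by_cases h0 : p = P1
          · refine ⟨p, q - 1, true, ?_, ?_, ?_, ?_⟩
            · left; unfold arm; left; simp at hq; refine ⟨rfl, ?_⟩; omega
            · intro h; have := bx_bounds h; omega
            · rw [hexAdj_iff]; simp
            · simp [f, dist]; simp at hq; omega
          · refine ⟨p - 1, q, true, ?_, ?_, ?_, ?_⟩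
            · left; unfold arm; left; refine ⟨rfl, ?_⟩; omega
            · unfold bx at hb ⊢; cases s <;> simp at hb ⊢ <;> omega
            · rw [hexAdj_iff]; simp
            · simp [f, dist]; omega
        · refine ⟨p, q, false, ?_, ?_, ?_, ?_⟩
          · left; unfold arm; left; refine ⟨rfl, ?_⟩; omega
          · unfold bx at hb ⊢; cases s <;> simp at hb ⊢ <;> omega
          · rw [hexAdj_iff]; simp
          · simp [f, dist]; omega
      · cases t
        · refine ⟨p, q - 1, true, ?_, ?_, ?_, ?_⟩
          · left; unfold arm; right; left; simp at hq; refine ⟨rfl, ?_⟩; omega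
          · unfold bx at hb ⊢; cases s <;> simp at hb ⊢ <;> omega
          · rw [hexAdj_iff]; simp
          · simp [f, dist]; simp at hq; omega
        · refine ⟨p, q, false, ?_, ?_, ?_, ?_⟩
          · left; unfold arm; right; left; refine ⟨rfl, ?_⟩; omega
          · unfold bx at hb ⊢; cases s <;> simp at hb ⊢ <;> omega
          · rw [hexAdj_iff]; simp
          · simp [f, dist]; omega
      · by_cases h0 : p = P3
        · cases t
          · refine ⟨p, q - 1, true, ?_, ?_, ?_, ?_⟩
            · left; unfold arm; right; right; simp at hq; refine ⟨rfl, ?_⟩; omega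
            · intro h; have := bx_bounds h; omega
            · rw [hexAdj_iff]; simp
            · simp [f, dist, h0]; simp at hq; omega
          · refine ⟨p, q, false, ?_, ?_, ?_, ?_⟩
            · left; unfold arm; right; right; refine ⟨rfl, ?_⟩; omega
            · intro h; have := bx_bounds h; omega
            · rw [hexAdj_iff]; simp
            · simp [f, dist, h0]; omega
        · have hlt : p < P3 := by omega
          cases t
          · refine ⟨p, q, true, ?_, ?_, ?_, ?_⟩
            · left; unfold arm; right; right; refine ⟨rfl, ?_⟩; omega
            · unfold bx at hb ⊢; cases s <;> simp at hb ⊢ <;> omega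
            · rw [hexAdj_iff]; simp
            · simp [f, dist, hlt]; omega
          · refine ⟨p + 1, q, false, ?_, ?_, ?_, ?_⟩
            · left; unfold arm; right; right; refine ⟨rfl, ?_⟩; omega
            · unfold bx at hb ⊢; cases s <;> simp at hb ⊢ <;> omega
            · rw [hexAdj_iff]; simp
            · simp only [f, dist]; simp [hlt]; split_ifs <;> omega
  obtain ⟨p', q', t', k1, k2, k3, k4⟩ := key
  refine ⟨(p', q', t'), ?_, ⟨k3, ⟨?_, k2⟩, ⟨hZ _ _ _ ha, hb⟩⟩, k4⟩
  · rcases k1 with k1 | ⟨rfl, rfl, rfl⟩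
    · right; exact ⟨k1, k2⟩
    · left; rfl
  · rcases k1 with k1 | ⟨rfl, rfl, rfl⟩
    · exact hZ _ _ _ k1
    · exact hv

lemma site_conn {S : Set HexV} {Z : ℤ → ℤ → Prop} (hZ : ∀ p q t, Z p q → ((p, q, t) : HexV) ∈ S)
    {p q p' q' : ℤ} (h : Z p q) (h' : Z p' q') (hd : |p - p'| + |q - q'| ≤ 1) (t t' : Bool) :
    ((p', q', t') : HexV) ∈ compOf S (p, q, t) := by
  have mate : ∀ p q t t', Z p q → ((p, q, t') : HexV) ∈ compOf S (p, q, t) := by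
    intro p q t t' h
    by_cases htt : t = t'
    · subst htt; exact compOf_self _ _
    · refine compOf_adj (compOf_self _ _) ⟨?_, hZ _ _ _ h, hZ _ _ _ h⟩
      rw [hexAdj_iff]; cases t <;> cases t' <;> simp at htt ⊢
  have step : ∃ s s', ((p', q', s') : HexV) ∈ compOf S (p, q, s) := by
    simp only [abs_eq_max_neg] at hd
    have : (p' = p ∧ q' = q) ∨ ((p' = p + 1 ∧ q' = q) ∨ (p' = p ∧ q' = q + 1)) ∨
        ((p' = p - 1 ∧ q' = q) ∨ (p' = p ∧ q' = q - 1)) := by omega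
    rcases this with h0 | h0 | h0
    · obtain ⟨rfl, rfl⟩ := h0
      exact ⟨true, true, compOf_self _ _⟩
    · refine ⟨true, false, compOf_adj (compOf_self _ _) ⟨?_, hZ _ _ _ h, hZ _ _ _ h'⟩⟩
      rw [hexAdj_iff]; left; exact ⟨rfl, rfl, Or.inr h0⟩
    · refine ⟨false, true, compOf_adj (compOf_self _ _) ⟨?_, hZ _ _ _ h, hZ _ _ _ h'⟩⟩
      rw [hexAdj_iff]; right; exact ⟨rfl, rfl, Or.inr h0⟩
  obtain ⟨s, s', hs⟩ := step
  exact compOf_trans (mate _ _ _ _ h) (compOf_trans hs (mate _ _ _ _ h'))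

lemma ZZ_step {P1 P3 : ℤ} (h1 : P1 ≤ -15) (h3 : 15 ≤ P3) {s : Bool} {p q : ℤ}
    (h : ZZ s P1 P3 p q) (h0 : ¬ (p = 0 ∧ q = 0)) :
    ∃ p' q', ZZ s P1 P3 p' q' ∧ |p' - p| + |q' - q| ≤ 1 ∧ p'.natAbs + q'.natAbs < p.natAbs + q.natAbs := by
  have hA : (∃ i, arm P1 P3 i p q) → ∃ p' q', ZZ s P1 P3 p' q' ∧ |p' - p| + |q' - q| ≤ 1 ∧
      p'.natAbs + q'.natAbs < p.natAbs + q.natAbs := by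
    rintro ⟨i, hi⟩
    have hc : ZZ s P1 P3 0 0 := by left; unfold boxSite; simp
    unfold arm at hi
    by_cases hq : q = 0
    · subst hq
      rcases hi with ⟨rfl, ha⟩ | ⟨rfl, ha⟩ | ⟨rfl, ha⟩
      · refine ⟨p + 1, 0, ?_, by simp, by omega⟩
        by_cases hp : p + 1 = 0
        · rw [hp]; exact hc
        · right; refine ⟨0, ?_⟩; unfold arm; left; refine ⟨rfl, ?_⟩; omega
      · omega
      · refine ⟨p - 1, 0, ?_, by simp, by omega⟩
        by_cases hp : p - 1 = 0
        · rw [hp]; exact hc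
        · right; refine ⟨2, ?_⟩; unfold arm; right; right; refine ⟨rfl, ?_⟩; omega
    · refine ⟨p, q + 1, ?_, by simp, by omega⟩
      by_cases hc0 : p = 0 ∧ q + 1 = 0
      · rw [hc0.1, hc0.2]; exact hc
      · right; refine ⟨i, ?_⟩; unfold arm
        rcases hi with ⟨rfl, ha⟩ | ⟨rfl, ha⟩ | ⟨rfl, ha⟩
        · left; refine ⟨rfl, ?_⟩; omega
        · right; left; refine ⟨rfl, ?_⟩; omega
        · right; right; refine ⟨rfl, ?_⟩; omega
  rcases h with h | h
  · have : ∃ p' q', boxSite s p' q' ∧ |p' - p| + |q' - q| ≤ 1 ∧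
        p'.natAbs + q'.natAbs < p.natAbs + q.natAbs := by
      simp only [abs_eq_max_neg]
      unfold boxSite at *
      cases s <;> simp at h ⊢
      · by_cases hp : p = 0
        · refine ⟨0, if 0 < q then q - 1 else q + 1, ?_⟩
          split_ifs <;> omega
        · refine ⟨if 0 < p then p - 1 else p + 1, q, ?_⟩
          split_ifs <;> omega
      · by_cases hq : q = 0
        · refine ⟨if 0 < p then p - 1 else p + 1, 0, ?_⟩
          split_ifs <;> omega
        · refine ⟨p, if 0 < q then q - 1 else q + 1, ?_⟩
          split_ifs <;> omega
    obtain ⟨p', q', k1, k2⟩ := this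
    exact ⟨p', q', Or.inl k1, k2⟩
  · exact hA h

lemma ZZ_conn {P1 P3 : ℤ} (h1 : P1 ≤ -15) (h3 : 15 ≤ P3) {s : Bool} {S : Set HexV}
    (hZ : ∀ p q t, ZZ s P1 P3 p q → ((p, q, t) : HexV) ∈ S) (p q : ℤ) (t : Bool)
    (h : ZZ s P1 P3 p q) : ((p, q, t) : HexV) ∈ compOf S (0, 0, true) := by
  have : ∀ n : ℕ, ∀ p q : ℤ, ∀ t, ZZ s P1 P3 p q → p.natAbs + q.natAbs < n →
      ((p, q, t) : HexV) ∈ compOf S (0, 0, true) := by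
    intro n
    induction n with
    | zero => intro p q t _ h; omega
    | succ n ih =>
      intro p q t h hn
      by_cases h0 : p = 0 ∧ q = 0
      · obtain ⟨rfl, rfl⟩ := h0
        exact site_conn hZ h h (by simp) _ _
      · obtain ⟨p', q', k1, k2, k3⟩ := ZZ_step h1 h3 h h0
        exact compOf_trans (ih p' q' true k1 (by omega)) (site_conn hZ k1 h k2 _ _)
  exact this _ p q t h (Nat.lt_succ_self _)

lemma geom {P1 P3 lo hi top : ℤ} (h1 : P1 ≤ -15) (h3 : 15 ≤ P3) (hlo : lo ≤ P1 - 5)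
    (hhi : P3 + 5 ≤ hi) (htop : 10 ≤ top) (s : Bool) (S S' R : Set HexV)
    (hR : ∀ p q t, ((p, q, t) : HexV) ∈ R ↔ (lo ≤ p ∧ p ≤ hi ∧ -15 ≤ q ∧ q ≤ top))
    (k1 : ∀ v, v ∉ R → (v ∈ S' ↔ v ∈ S))
    (k2 : ∀ p q t, ZZ s P1 P3 p q → ((p, q, t) : HexV) ∈ S')
    (k3 : ∀ p q t, ((p, q, t) : HexV) ∈ R → ((p, q, t) : HexV) ∈ S' → ¬ ZZ s P1 P3 p q →
      (p = lo ∨ p = hi ∨ q = -15 ∨ q = top) ∧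
      ∀ p' q' t', HexAdj (p, q, t) (p', q', t') → ((p', q', t') : HexV) ∈ S' → ZZ s P1 P3 p' q')
    (hv : ∀ i, ((Pv P1 P3 i, -16, true) : HexV) ∈ S)
    (hinf : ∀ i, (compOf (S \ R) (Pv P1 P3 i, -16, true)).Infinite)
    (hdist : ∀ i j, i ≠ j → ((Pv P1 P3 j, -16, true) : HexV) ∉ compOf S (Pv P1 P3 i, -16, true)) :
    SetEnc S' (bx s 1) (bx s 3) := by
  have hvR : ∀ i, ((Pv P1 P3 i, -16, true) : HexV) ∉ R := by
    intro i h; rw [hR] at h; omega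
  have hvB : ∀ i, ((Pv P1 P3 i, -16, true) : HexV) ∉ bx s 3 := by
    intro i h; have := bx_bounds h; omega
  have hvS' : ∀ i, ((Pv P1 P3 i, -16, true) : HexV) ∈ S' := fun i => (k1 _ (hvR i)).2 (hv i)
  have hBR : ∀ p q t, ((p, q, t) : HexV) ∈ bx s 3 → ((p, q, t) : HexV) ∈ R := by
    intro p q t h; have := bx_bounds h; rw [hR]; omega
  have hZZb : ∀ p q, ZZ s P1 P3 p q → P1 ≤ p ∧ p ≤ P3 ∧ -15 ≤ q ∧ q ≤ 3 := by
    rintro p q (h | ⟨i, h⟩)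
    · have := boxSite_bounds h; omega
    · have := arm_bounds h1 h3 h; omega
  have hc0 : ZZ s P1 P3 0 0 := by left; unfold boxSite; simp
  -- boundary adjacency
  have hbd : ∀ p q t p' q' t', ((p, q, t) : HexV) ∈ R → ((p', q', t') : HexV) ∉ R →
      HexAdj (p, q, t) (p', q', t') → ∀ i, arm P1 P3 i p q →
      ((p', q', t') : HexV) = (Pv P1 P3 i, -16, true) := by
    intro p q t p' q' t' hr hr' hadj i hi
    have hb := arm_bounds h1 h3 hi
    rw [hR] at hr hr'
    rw [hexAdj_iff] at hadj
    have hq : q = -15 := by omega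
    have hp := hb.2.2.2.2 hq
    have ht' : t' = true := by
      rcases hadj with ⟨_, _, h⟩ | ⟨_, h, _⟩
      · omega
      · exact h
    subst ht'
    have : p' = p ∧ q' = -16 := by omega
    rw [this.1, this.2, hp]
  have hnotbox : ∀ p q t, ((p, q, t) : HexV) ∉ bx s 3 → ZZ s P1 P3 p q → ∃ i, arm P1 P3 i p q := by
    rintro p q t hn (h | h)
    · exact absurd (boxSite_bx h t) hn
    · exact h
  refine enc_abs S' (bx s 1) (bx s 3) (0, 0, true) (fun i => (Pv P1 P3 i, -16, true)) ?_ ?_ ?_ ?_ ?_ ?_ ?_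
  · refine ⟨k2 _ _ _ hc0, ?_⟩
    unfold bx; simp
  · rintro ⟨p, q, t⟩ hb
    exact ZZ_conn h1 h3 k2 p q t (Or.inl (bx_boxSite hb))
  · rintro ⟨p, q, t⟩ ⟨_, huB⟩ ⟨p', q', t'⟩ ⟨hwS, hwB⟩ hadj
    have hb := bx_bounds huB
    have hd := hexAdj_dist hadj
    simp only [abs_eq_max_neg] at hd
    have hwR : ((p', q', t') : HexV) ∈ R := by rw [hR]; omega
    have hz : ZZ s P1 P3 p' q' := by
      by_contra hz
      have := (k3 _ _ _ hwR hwS hz).1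
      omega
    obtain ⟨i, hi⟩ := hnotbox _ _ _ hwB hz
    exact ⟨i, arm_conn h1 h3 s i S' (hvS' i) (fun p q t h => k2 p q t (Or.inr ⟨i, h⟩)) _ _ _ hi hwB⟩
  · exact fun i => ⟨hvS' i, hvB i⟩
  · intro i
    have hz : ZZ s P1 P3 (Pv P1 P3 i) (-15) := Or.inr ⟨i, arm_end i⟩
    refine compOf_adj (ZZ_conn h1 h3 k2 _ _ false hz) ⟨?_, k2 _ _ _ hz, hvS' i⟩
    rw [hexAdj_iff]; simp
  · intro i
    refine (hinf i).mono (compOf_mono ?_ _)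
    rintro ⟨p, q, t⟩ ⟨h, hr⟩
    exact ⟨(k1 _ hr).2 h, fun hb => hr (hBR _ _ _ hb)⟩
  · intro i j hij hmem
    let W : Set HexV := {v | (v ∉ R ∧ v ∈ compOf S (Pv P1 P3 i, -16, true)) ∨
      (v ∈ R ∧ (arm P1 P3 i v.1 v.2.1 ∨ (v ∈ S' ∧ ¬ ZZ s P1 P3 v.1 v.2.1 ∧
        ∃ p q, arm P1 P3 i p q ∧ |v.1 - p| + |v.2.1 - q| ≤ 1)))}
    have hW : ((Pv P1 P3 j, -16, true) : HexV) ∈ W := by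
      refine compOf_closed (W := W) (Or.inl ⟨hvR i, compOf_self _ _⟩) ?_ hmem
      rintro ⟨p, q, t⟩ ⟨p', q', t'⟩ hv1 ⟨hadj, ⟨hvS, hvB⟩, ⟨hwS, hwB⟩⟩
      have hd := hexAdj_dist hadj
      by_cases hw : ((p', q', t') : HexV) ∈ R
      · right
        refine ⟨hw, ?_⟩
        rcases hv1 with ⟨hr, hcomp⟩ | ⟨hr, ha | ⟨_, hnz, p0, q0, ha0, hd0⟩⟩
        · -- outside to inside
          have hz : ZZ s P1 P3 p' q' := by
            by_contra hz
            have h := hZZb _ _ ((k3 _ _ _ hw hwS hz).2 _ _ _ (hexAdj_symm hadj) hvS)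
            apply hr; rw [hR]; omega
          obtain ⟨l, hl⟩ := hnotbox _ _ _ hwB hz
          have := hbd _ _ _ _ _ _ hw hr (hexAdj_symm hadj) l hl
          by_cases hil : i = l
          · subst hil; left; exact hl
          · rw [this] at hcomp
            exact absurd hcomp (hdist i l hil)
        · by_cases hz : ZZ s P1 P3 p' q'
          · obtain ⟨l, hl⟩ := hnotbox _ _ _ hwB hz
            rcases arm_adj h1 h3 ha hl (by simp only; omega) with rfl | h
            · left; exact hl
            · simp only at h; omega
          · right
            refine ⟨hwS, hz, p, q, ha, ?_⟩
            simp only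
            rw [abs_sub_comm p' p, abs_sub_comm q' q]; exact hd
        · have hz := (k3 _ _ _ hr hvS hnz).2 _ _ _ hadj hwS
          have hring := (k3 _ _ _ hr hvS hnz).1
          obtain ⟨l, hl⟩ := hnotbox _ _ _ hwB hz
          left
          have hdd : |p0 - p'| + |q0 - q'| ≤ 2 := by
            simp only [abs_eq_max_neg] at *; omega
          rcases arm_adj h1 h3 ha0 hl hdd with rfl | h
          · exact hl
          · exfalso
            simp only [abs_eq_max_neg] at *
            have := arm_bounds h1 h3 ha0
            omega
      · left
        refine ⟨hw, ?_⟩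
        rcases hv1 with ⟨hr, hcomp⟩ | ⟨hr, ha | ⟨_, hnz, p0, q0, ha0, hd0⟩⟩
        · exact compOf_adj hcomp ⟨hadj, (k1 _ hr).1 hvS, (k1 _ hw).1 hwS⟩
        · rw [hbd _ _ _ _ _ _ hr hw hadj i ha]; exact compOf_self _ _
        · have h := hZZb _ _ ((k3 _ _ _ hr hvS hnz).2 _ _ _ hadj hwS)
          exfalso; apply hw; rw [hR]; omega
    rcases hW with ⟨_, h⟩ | ⟨h, _⟩
    · exact hdist i j hij h
    · exact hvR j h

/-! ### Frames -/

lemma fill' (M : ℤ) (hM : 5 ≤ M) (Z : ℤ → ℤ → Prop) (ω : Config) (hω : IsConfig ω)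
    (hZR : ∀ x k, Z x k → -M ≤ x ∧ x ≤ M ∧ -M ≤ k ∧ k ≤ M)
    (hZ1 : ∀ x k, Z x k → (-M + 3 ≤ x ∧ x ≤ M - 3) ∨ (-M + 3 ≤ k ∧ k ≤ M - 3))
    (hT : ∀ x, Z x M → (x, M + 1 - x, true) ∈ confSet ω conf001)
    (hB : ∀ x, Z x (-M) → (x, -M - x, false) ∈ confSet ω conf001)
    (hL : ∀ k, Z (-M) k → (-M - 1, k + M + 1, true) ∈ confSet ω conf001)
    (hR : ∀ k, Z M k → (M + 1, k - M, false) ∈ confSet ω conf001) :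
    ∃ ω' : Config, IsConfig ω' ∧ {e | ω e ≠ ω' e}.Finite ∧
      (∀ v, v ∉ Reg M → (v ∈ confSet ω' conf001 ↔ v ∈ confSet ω conf001)) ∧
      (∀ v, Z v.1 (sk v) → v ∈ confSet ω' conf001) ∧
      (∀ v, v ∈ Reg M → v ∈ confSet ω' conf001 → ¬ Z v.1 (sk v) →
        (v.1 = -M ∨ v.1 = M) ∧ ∀ v', HexAdj v v' → v' ∈ confSet ω' conf001 → Z v'.1 (sk v')) := by
  obtain ⟨ω', h1, h2, h3, h4, h5⟩ := fill M hM Z ω hω hZR hZ1 hT hB hL hR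
  refine ⟨ω', h1, h2, h3, h4, ?_⟩
  intro v hv hS hz
  have hj := h5 v hv hS hz
  refine ⟨by omega, ?_⟩
  intro v' hadj hS'
  by_contra hz'
  obtain ⟨x, y, t⟩ := v
  obtain ⟨x', y', t'⟩ := v'
  rw [hexAdj_iff] at hadj
  have hv' : ((x', y', t') : HexV) ∈ Reg M := by
    unfold Reg at hv ⊢
    cases t <;> cases t' <;> simp [sk] at hv hj hadj ⊢ <;> omega
  have hj' := h5 _ hv' hS' hz'
  cases t <;> cases t' <;> simp [sk] at hj hj' hadj <;> omega

def frF (s r : Bool) (u w : ℤ) (v : HexV) : HexV :=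
  ((if r then (if s then v.1 + u else v.2.1 + w) else -(if s then v.1 + u else v.2.1 + w)),
    (if r then -(if s then v.2.1 + w else v.1 + u) else (if s then v.2.1 + w else v.1 + u)) -
      (if r then (if s then v.1 + u else v.2.1 + w) else -(if s then v.1 + u else v.2.1 + w)) +
      (if v.2.2 = r then 0 else 1), decide (v.2.2 = r))

def frG (s r : Bool) (u w : ℤ) (v : HexV) : HexV :=
  ((if s then (if r then v.1 else - v.1) else (if r then -sk v else sk v)) - u,
   (if s then (if r then -sk v else sk v) else (if r then v.1 else - v.1)) - w, decide (v.2.2 = r))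

def fr (s r : Bool) (u w : ℤ) : HexV ≃ HexV where
  toFun := frF s r u w
  invFun := frG s r u w
  left_inv := by
    rintro ⟨p, q, t⟩
    cases s <;> cases r <;> cases t <;> simp [frF, frG, sk] <;> omega
  right_inv := by
    rintro ⟨p, q, t⟩
    cases s <;> cases r <;> cases t <;> simp [frF, frG, sk] <;> omega

lemma fr_adj (s r : Bool) (u w : ℤ) (v v' : HexV) :
    HexAdj (fr s r u w v) (fr s r u w v') ↔ HexAdj v v' := by
  obtain ⟨p, q, t⟩ := v
  obtain ⟨p', q', t'⟩ := v'
  change HexAdj (frF s r u w (p, q, t)) (frF s r u w (p', q', t')) ↔ _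
  unfold frF
  rw [hexAdj_iff, hexAdj_iff]
  cases s <;> cases r <;> cases t <;> cases t' <;> simp <;> omega

lemma fr_reg (s r : Bool) (u w M p q : ℤ) (t : Bool) :
    fr s r u w (p, q, t) ∈ Reg M ↔ (-M ≤ p + u ∧ p + u ≤ M ∧ -M ≤ q + w ∧ q + w ≤ M) := by
  change frF s r u w (p, q, t) ∈ Reg M ↔ _
  unfold frF Reg
  cases s <;> cases r <;> cases t <;> simp [sk] <;> omega

lemma fr_box (s r : Bool) (u w : ℤ) : ∃ i j, ∀ n : ℕ, fr s r u w ⁻¹' (box n i j) = bx s n := by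
  refine ⟨if r then (if s then u else w) else -(if s then u else w),
    if r then -u - w else u + w + 1, ?_⟩
  intro n
  ext ⟨p, q, t⟩
  change frF s r u w (p, q, t) ∈ box n _ _ ↔ _
  unfold frF box bx
  cases s <;> cases r <;> cases t <;> simp [abs_le] <;> omega

lemma fr_fill (s r : Bool) (u w M : ℤ) (hM : 5 ≤ M) (Z : ℤ → ℤ → Prop) (ω : Config) (hω : IsConfig ω)
    (hZ : ∀ p q, Z p q → -M + 3 ≤ p + u ∧ p + u ≤ M - 3 ∧ -M ≤ q + w ∧ q + w ≤ M - 3)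
    (hE : ∀ p, Z p (-M - w) → fr s r u w (p, -M - 1 - w, true) ∈ confSet ω conf001) :
    ∃ ω' : Config, IsConfig ω' ∧ {e | ω e ≠ ω' e}.Finite ∧
      (∀ v, fr s r u w v ∉ Reg M → (fr s r u w v ∈ confSet ω' conf001 ↔ fr s r u w v ∈ confSet ω conf001)) ∧
      (∀ p q t, Z p q → fr s r u w (p, q, t) ∈ confSet ω' conf001) ∧
      (∀ p q t, fr s r u w (p, q, t) ∈ Reg M → fr s r u w (p, q, t) ∈ confSet ω' conf001 → ¬ Z p q →
        (p = -M - u ∨ p = M - u ∨ q = -M - w ∨ q = M - w) ∧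
        ∀ p' q' t', HexAdj (p, q, t) (p', q', t') →
          fr s r u w (p', q', t') ∈ confSet ω' conf001 → Z p' q') := by
  let Z' : ℤ → ℤ → Prop := fun x k =>
    Z ((if s then (if r then x else - x) else (if r then -k else k)) - u)
      ((if s then (if r then -k else k) else (if r then x else - x)) - w)
  have hZ' : ∀ p q t, Z' (fr s r u w (p, q, t)).1 (sk (fr s r u w (p, q, t))) ↔ Z p q := by
    intro p q t
    change Z (frG s r u w (fr s r u w (p, q, t))).1 (frG s r u w (fr s r u w (p, q, t))).2.1 ↔ Z p q
    have : frG s r u w (fr s r u w (p, q, t)) = (p, q, t) := (fr s r u w).left_inv _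
    rw [this]
  have hfill := fill' M hM Z' ω hω ?_ ?_ ?_ ?_ ?_ ?_
  · obtain ⟨ω', h1, h2, h3, h4, h5⟩ := hfill
    refine ⟨ω', h1, h2, fun v hv => h3 _ hv, fun p q t h => h4 _ ((hZ' _ _ _).2 h), ?_⟩
    intro p q t hr hS hz
    obtain ⟨k1, k2⟩ := h5 _ hr hS (fun h => hz ((hZ' _ _ _).1 h))
    refine ⟨?_, ?_⟩
    · change (frF s r u w (p, q, t)).1 = -M ∨ (frF s r u w (p, q, t)).1 = M at k1
      unfold frF at k1
      cases s <;> cases r <;> simp at k1 <;> omega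
    · intro p' q' t' hadj hS'
      exact (hZ' _ _ _).1 (k2 _ ((fr_adj _ _ _ _ _ _).2 hadj) hS')
  · intro x k h
    have := hZ _ _ h
    cases s <;> cases r <;> simp at this <;> omega
  · intro x k h
    have := hZ _ _ h
    cases s <;> cases r <;> simp at this <;> omega
  · intro x h
    have hh := hZ _ _ h
    cases s <;> cases r <;> simp at hh <;> try omega
    have := hE (x - u) (by simpa [Z'] using h)
    change frF true true u w _ ∈ _ at this
    refine (congrArg (· ∈ confSet ω conf001) ?_).mpr this
    simp [frF] <;> omega
  · intro x h
    have hh := hZ _ _ h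
    cases s <;> cases r <;> simp at hh <;> try omega
    have := hE (-x - u) (by simpa [Z'] using h)
    change frF true false u w _ ∈ _ at this
    refine (congrArg (· ∈ confSet ω conf001) ?_).mpr this
    simp [frF] <;> omega
  · intro x h
    have hh := hZ _ _ h
    cases s <;> cases r <;> simp at hh <;> try omega
    have := hE (-x - u) (by simpa [Z'] using h)
    change frF false true u w _ ∈ _ at this
    refine (congrArg (· ∈ confSet ω conf001) ?_).mpr this
    simp [frF] <;> omega
  · intro x h
    have hh := hZ _ _ h
    cases s <;> cases r <;> simp at hh <;> try omega
    have := hE (x - u) (by simpa [Z'] using h)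
    change frF false false u w _ ∈ _ at this
    refine (congrArg (· ∈ confSet ω conf001) ?_).mpr this
    simp [frF] <;> omega

lemma fr_exit (M : ℤ) (v w : HexV) (hv : v ∉ Reg M) (hw : w ∈ Reg M) (h : HexAdj v w) :
    ∃ s r p, -M ≤ p ∧ p ≤ M ∧ v = fr s r 0 0 (p, -M - 1, true) := by
  obtain ⟨x, y, t⟩ := v
  obtain ⟨x', y', t'⟩ := w
  have key : (t = true ∧ -M ≤ x ∧ x ≤ M ∧ x + y = M + 1) ∨ (t = true ∧ x = -M - 1 ∧ -M ≤ x + y ∧ x + y ≤ M) ∨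
      (t = false ∧ -M ≤ x ∧ x ≤ M ∧ x + y - 1 = -M - 1) ∨
      (t = false ∧ x = M + 1 ∧ -M ≤ x + y - 1 ∧ x + y - 1 ≤ M) := by
    rw [hexAdj_iff] at h
    unfold Reg at hv hw
    cases t <;> cases t' <;> simp [sk] at hv hw h ⊢ <;> omega
  rcases key with ⟨rfl, k⟩ | ⟨rfl, k⟩ | ⟨rfl, k⟩ | ⟨rfl, k⟩
  · refine ⟨true, true, x, by omega, by omega, ?_⟩
    change _ = frF true true 0 0 _
    simp [frF]; omega
  · refine ⟨false, true, -(x + y), by omega, by omega, ?_⟩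
    change _ = frF false true 0 0 _
    simp [frF]; omega
  · refine ⟨true, false, -x, by omega, by omega, ?_⟩
    change _ = frF true false 0 0 _
    simp [frF]; omega
  · refine ⟨false, false, x + y - 1, by omega, by omega, ?_⟩
    change _ = frF false false 0 0 _
    simp [frF]; omega

lemma fr_zero (s r : Bool) (u w p q : ℤ) (t : Bool) :
    fr s r u w (p, q, t) = fr s r 0 0 (p + u, q + w, t) := by
  change frF s r u w _ = frF s r 0 0 _
  simp [frF]

/-! ### Combination -/

lemma combine (ω : Config) (hω : IsConfig ω) (M : ℤ) (s r : Bool) (p1 p2 p3 : ℤ)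
    (h12 : p1 + 15 ≤ p2) (h23 : p2 + 15 ≤ p3) (hlo : -M + 15 ≤ p1) (hhi : p3 ≤ M - 15)
    (pp : Fin 3 → ℤ) (hp0 : pp 0 = p1) (hp1 : pp 1 = p2) (hp2 : pp 2 = p3)
    (hS : ∀ i, fr s r 0 0 (pp i, -M - 1, true) ∈ confSet ω conf001)
    (hinf : ∀ i, (compOf (confSet ω conf001 \ Reg M) (fr s r 0 0 (pp i, -M - 1, true))).Infinite)
    (hdist : ∀ i j, i ≠ j → fr s r 0 0 (pp j, -M - 1, true) ∉
      compOf (confSet ω conf001) (fr s r 0 0 (pp i, -M - 1, true))) :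
    ∃ ω', (∃ i j, IsEncounterBox ω' 1 i j) ∧ IsConfig ω' ∧ {e | ω e ≠ ω' e}.Finite := by
  have hPv : ∀ i, Pv (p1 - p2) (p3 - p2) i + p2 = pp i := by
    intro i
    unfold Pv
    fin_cases i
    · simp [hp0]
    · simp [hp1]
    · simp [hp2]
  have hfr : ∀ i, fr s r p2 (-M + 15) (Pv (p1 - p2) (p3 - p2) i, -16, true) =
      fr s r 0 0 (pp i, -M - 1, true) := by
    intro i
    rw [fr_zero, hPv i]
    congr 3; omega
  obtain ⟨ω', k1, k2, k3, k4, k5⟩ := fr_fill s r p2 (-M + 15) M (by omega)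
    (ZZ s (p1 - p2) (p3 - p2)) ω hω (by
      rintro p q (h | ⟨i, h⟩)
      · have := boxSite_bounds h; omega
      · have := arm_bounds (by omega) (by omega) h; omega) (by
      rintro p (h | ⟨i, h⟩)
      · have := boxSite_bounds h; omega
      · have e : -M - (-M + 15) = -15 := by ring
        rw [e] at h
        have := (arm_bounds (by omega) (by omega) h).2.2.2.2 rfl
        have e' : -M - 1 - (-M + 15) = -16 := by ring
        rw [this, e', hfr i]
        exact hS i)
  refine ⟨ω', ?_, k1, k2⟩
  obtain ⟨i, j, hbox⟩ := fr_box s r p2 (-M + 15)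
  refine ⟨i, j, ?_⟩
  change SetEnc (confSet ω' conf001) (box 1 i j) (box (1 + 2) i j)
  apply setEnc_preimage (fr s r p2 (-M + 15)) (fr_adj _ _ _ _)
  rw [hbox, hbox]
  have := geom (P1 := p1 - p2) (P3 := p3 - p2) (lo := -M - p2) (hi := M - p2) (top := 2 * M - 15)
    (by omega) (by omega) (by omega) (by omega) (by omega) s
    (fr s r p2 (-M + 15) ⁻¹' confSet ω conf001) (fr s r p2 (-M + 15) ⁻¹' confSet ω' conf001)
    (fr s r p2 (-M + 15) ⁻¹' Reg M)
    (by intro p q t; rw [Set.mem_preimage, fr_reg]; omega)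
    k3 k4
    (by
      intro p q t hr hs hz
      obtain ⟨g1, g2⟩ := k5 p q t hr hs hz
      exact ⟨by omega, g2⟩)
    (by intro i; rw [Set.mem_preimage, hfr]; exact hS i)
    (by
      intro i
      rw [← Set.preimage_sdiff, compOf_preimage _ (fr_adj _ _ _ _), infinite_preimage, hfr]
      exact hinf i)
    (by
      intro i j hij
      rw [compOf_preimage _ (fr_adj _ _ _ _), Set.mem_preimage, hfr, hfr]
      exact hdist i j hij)
  exact_mod_cast this

lemma reg_finite (M : ℤ) : (Reg M).Finite := by
  refine Set.Finite.subset (Finset.finite_toSet ((Finset.Icc (-M) M) ×ˢ ((Finset.Icc (-2*M) (2*M+1)) ×ˢ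
    (Finset.univ : Finset Bool)) : Finset HexV)) ?_
  rintro ⟨x, y, t⟩ h
  simp only [Finset.coe_product, Set.mem_prod, Finset.coe_Icc, Set.mem_Icc, Finset.coe_univ, Set.mem_univ, and_true]
  unfold Reg at h
  cases t <;> simp [sk] at h <;> omega

lemma exit_exists (S : Set HexV) (M : ℤ) (v : HexV) (hv : v ∈ S) (hvR : v ∈ Reg M)
    (hinf : (compOf S v).Infinite) :
    ∃ s r p, -M ≤ p ∧ p ≤ M ∧ fr s r 0 0 (p, -M - 1, true) ∈ compOf S v ∧
      (compOf (S \ Reg M) (fr s r 0 0 (p, -M - 1, true))).Infinite := by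
  by_contra hcon
  push Not at hcon
  apply hinf
  let E : Set HexV := {e | e ∈ compOf S v ∧ e ∉ Reg M ∧ ∃ w ∈ Reg M, HexAdj e w}
  have hE : E.Finite := by
    refine Set.Finite.subset ((Finset.finite_toSet ((Finset.univ : Finset Bool) ×ˢ
      ((Finset.univ : Finset Bool) ×ˢ Finset.Icc (-M) M))).image
      (fun a : Bool × Bool × ℤ => fr a.1 a.2.1 0 0 (a.2.2, -M - 1, true))) ?_
    rintro e ⟨_, he, w, hw, hadj⟩
    obtain ⟨s, r, p, h1, h2, h3⟩ := fr_exit M e w he hw hadj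
    exact ⟨(s, r, p), by simp [h1, h2], h3.symm⟩
  have hfin : ∀ e ∈ E, (compOf (S \ Reg M) e).Finite := by
    rintro e ⟨hc, he, w, hw, hadj⟩
    obtain ⟨s, r, p, h1, h2, rfl⟩ := fr_exit M e w he hw hadj
    exact hcon s r p h1 h2 hc
  refine Set.Finite.subset ((reg_finite M).union (hE.biUnion hfin)) ?_
  have : compOf S v ⊆ {w | w ∈ compOf S v ∧ w ∈ Reg M ∪ ⋃ e ∈ E, compOf (S \ Reg M) e} := by
    refine compOf_closed ⟨compOf_self _ _, Or.inl hvR⟩ ?_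
    rintro a b ⟨h1, h2⟩ hab
    have hb : b ∈ compOf S v := compOf_adj h1 hab
    refine ⟨hb, ?_⟩
    by_cases hbR : b ∈ Reg M
    · exact Or.inl hbR
    · right
      simp only [Set.mem_iUnion]
      by_cases haR : a ∈ Reg M
      · exact ⟨b, ⟨hb, hbR, a, haR, hexAdj_symm hab.1⟩, compOf_self _ _⟩
      · rcases h2 with h2 | h2
        · exact absurd h2 haR
        · simp only [Set.mem_iUnion] at h2
          obtain ⟨e, he, h2⟩ := h2
          exact ⟨e, he, compOf_adj h2 ⟨hab.1, ⟨hab.2.1, haR⟩, ⟨hab.2.2, hbR⟩⟩⟩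
  exact fun w hw => (this hw).2

lemma exists_reg (F : Finset HexV) : ∃ M : ℤ, ∀ v ∈ F, v ∈ Reg M := by
  refine ⟨((F.sup (fun v => v.1.natAbs + v.2.1.natAbs + 1) : ℕ) : ℤ), fun v hv => ?_⟩
  have : v.1.natAbs + v.2.1.natAbs + 1 ≤ F.sup (fun v : HexV => v.1.natAbs + v.2.1.natAbs + 1) :=
    Finset.le_sup (f := fun v : HexV => v.1.natAbs + v.2.1.natAbs + 1) hv
  unfold Reg sk
  simp only [Set.mem_ofPred_eq]
  split_ifs <;> omega

lemma gap {n : ℕ} (f : Fin n ↪o ℤ) (i k : ℕ) (h : i + k < n) :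
    f ⟨i, by omega⟩ + k ≤ f ⟨i + k, h⟩ := by
  induction k with
  | zero => simp
  | succ k ih =>
    have h1 := ih (by omega)
    have h2 : f ⟨i + k, by omega⟩ < f ⟨i + (k + 1), h⟩ := f.strictMono (by simp [Fin.lt_def])
    push_cast
    omega

lemma selection (ω : Config) (hω : IsConfig ω) (hn : numInfClusters ω conf001 = ⊤) :
    ∃ ω', (∃ i j, IsEncounterBox ω' 1 i j) ∧ IsConfig ω' ∧ {e | ω e ≠ ω' e}.Finite := by
  classical
  set S := confSet ω conf001 with hSdef
  have hinf : {C : Set HexV | IsCluster ω conf001 C ∧ C.Infinite}.Infinite := by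
    rw [← Set.encard_eq_top_iff]; exact hn
  obtain ⟨T, hT, hcard⟩ := hinf.exists_subset_card_eq 241
  have hrep : ∀ C, ∃ v, C ∈ T → v ∈ S ∧ C = compOf S v := by
    intro C
    by_cases h : C ∈ T
    · obtain ⟨v, h1, h2⟩ := (hT h).1
      exact ⟨v, fun _ => ⟨h1, h2⟩⟩
    · exact ⟨(0, 0, true), fun h' => absurd h' h⟩
  choose x hx using hrep
  obtain ⟨M, hM⟩ := exists_reg (T.image x)
  have hex : ∀ C, ∃ s r p, C ∈ T → (-M ≤ p ∧ p ≤ M ∧ fr s r 0 0 (p, -M - 1, true) ∈ C ∧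
      (compOf (S \ Reg M) (fr s r 0 0 (p, -M - 1, true))).Infinite) := by
    intro C
    by_cases h : C ∈ T
    · obtain ⟨h1, h2⟩ := hx C h
      obtain ⟨s, r, p, h3⟩ := exit_exists S M (x C) h1 (hM _ (Finset.mem_image_of_mem x h))
        (by rw [← h2]; exact (hT h).2)
      rw [← h2] at h3
      exact ⟨s, r, p, fun _ => h3⟩
    · exact ⟨true, true, 0, fun h' => absurd h' h⟩
  choose s r p hp using hex
  obtain ⟨⟨s0, r0⟩, _, hfib⟩ := Finset.exists_lt_card_fiber_of_mul_lt_card_of_maps_to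
    (s := T) (t := (Finset.univ : Finset (Bool × Bool))) (f := fun C => (s C, r C)) (n := 60)
    (fun _ _ => Finset.mem_univ _) (by rw [hcard]; simp)
  set T' := T.filter (fun C => (s C, r C) = (s0, r0)) with hT'
  have hmem : ∀ C ∈ T', C ∈ T ∧ s C = s0 ∧ r C = r0 := by
    intro C hC
    rw [hT', Finset.mem_filter] at hC
    exact ⟨hC.1, (Prod.mk.inj hC.2).1, (Prod.mk.inj hC.2).2⟩
  have hcomp : ∀ C ∈ T', ∀ v ∈ C, C = compOf S v := by
    intro C hC v hv
    have h := (hx C (hmem C hC).1).2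
    have hv' : v ∈ compOf S (x C) := by rw [← h]; exact hv
    rw [compOf_eq hv']; exact h
  have hpC : ∀ C ∈ T', (-M ≤ p C ∧ p C ≤ M ∧ fr s0 r0 0 0 (p C, -M - 1, true) ∈ C ∧
      (compOf (S \ Reg M) (fr s0 r0 0 0 (p C, -M - 1, true))).Infinite) := by
    intro C hC
    obtain ⟨h1, h2, h3⟩ := hmem C hC
    have := hp C h1
    rwa [h2, h3] at this
  have hinj : Set.InjOn p T' := by
    intro C hC C' hC' he
    have h1 := hcomp C hC _ (hpC C hC).2.2.1
    have h2 := hcomp C' hC' _ (hpC C' hC').2.2.1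
    rw [h1, h2, he]
  obtain ⟨Q, hQ, hQc⟩ := Finset.exists_subset_card_eq (s := T'.image p) (n := 61)
    (by rw [Finset.card_image_of_injOn hinj]; exact hfib)
  let f := Q.orderEmbOfFin hQc
  have hfC : ∀ i, ∃ C ∈ T', p C = f i := by
    intro i
    have := hQ (Finset.orderEmbOfFin_mem Q hQc i)
    simpa using Finset.mem_image.1 this
  choose c hc hcf using hfC
  let idx : Fin 3 → Fin 61 := ![15, 30, 45]
  have hb : ∀ i, -M ≤ f i ∧ f i ≤ M := by
    intro i
    have := hpC _ (hc i)
    rw [hcf] at this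
    exact ⟨this.1, this.2.1⟩
  have g1 : f ⟨0, by omega⟩ + 15 ≤ f ⟨15, by omega⟩ := gap f 0 15 (by omega)
  have g2 : f ⟨15, by omega⟩ + 15 ≤ f ⟨30, by omega⟩ := gap f 15 15 (by omega)
  have g3 : f ⟨30, by omega⟩ + 15 ≤ f ⟨45, by omega⟩ := gap f 30 15 (by omega)
  have g4 : f ⟨45, by omega⟩ + 15 ≤ f ⟨60, by omega⟩ := gap f 45 15 (by omega)
  have b1 := (hb ⟨0, by omega⟩).1
  have b2 := (hb ⟨60, by omega⟩).2
  refine combine ω hω M s0 r0 (f ⟨15, by omega⟩) (f ⟨30, by omega⟩) (f ⟨45, by omega⟩)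
    g2 g3 ?_ ?_ (fun i => f (idx i)) rfl rfl rfl ?_ ?_ ?_
  · omega
  · omega
  · intro i
    have h := (hpC _ (hc (idx i))).2.2.1
    rw [hcf] at h
    obtain ⟨h1, h2⟩ := hx _ (hmem _ (hc (idx i))).1
    rw [h2] at h
    exact compOf_subset h1 h
  · intro i
    have h := (hpC _ (hc (idx i))).2.2.2
    rw [hcf] at h
    exact h
  · intro i j hij hm
    have hi := (hpC _ (hc (idx i))).2.2.1
    have hj := (hpC _ (hc (idx j))).2.2.1
    rw [hcf] at hi hj
    have e1 := hcomp _ (hc (idx i)) _ hi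
    have e2 := hcomp _ (hc (idx j)) _ hj
    have e3 := compOf_eq hm
    have : c (idx i) = c (idx j) := by rw [e1, e2]; exact e3.symm
    have hf : f (idx i) = f (idx j) := by rw [← hcf, ← hcf, this]
    have hidx : idx i = idx j := f.injective hf
    apply hij
    revert hidx
    clear * -
    revert i j
    decide

/-! ### Translation -/

def trE (g : ℤ × ℤ) : HexV ≃ HexV where
  toFun v := (v.1 - g.1, v.2.1 - g.2, v.2.2)
  invFun v := (v.1 + g.1, v.2.1 + g.2, v.2.2)
  left_inv := by rintro ⟨x, y, t⟩; simp
  right_inv := by rintro ⟨x, y, t⟩; simp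

lemma trE_adj (g : ℤ × ℤ) (v w : HexV) : HexAdj (trE g v) (trE g w) ↔ HexAdj v w := by
  obtain ⟨x, y, t⟩ := v
  obtain ⟨x', y', t'⟩ := w
  change HexAdj (x - g.1, y - g.2, t) (x' - g.1, y' - g.2, t') ↔ _
  rw [hexAdj_iff, hexAdj_iff]
  cases t <;> cases t' <;> simp <;> omega

lemma shift_edgesAt (g : ℤ × ℤ) (v : HexV) (k : Fin 3) :
    shiftE g (edgesAt (trE g v) k) = edgesAt v k := by
  obtain ⟨x, y, t⟩ := v
  change shiftE g (edgesAt (x - g.1, y - g.2, t) k) = edgesAt (x, y, t) k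
  unfold shiftE edgesAt
  cases t <;> fin_cases k <;> simp <;> omega

lemma localConf_shift (g : ℤ × ℤ) (ω : Config) (v : HexV) :
    localConf (shiftConfig g ω) (trE g v) = localConf ω v := by
  funext k
  unfold localConf shiftConfig
  rw [shift_edgesAt]

lemma isConfig_shift (g : ℤ × ℤ) (ω : Config) (h : IsConfig ω) : IsConfig (shiftConfig g ω) := by
  intro v
  obtain ⟨v, rfl⟩ := (trE g).surjective v
  rw [localConf_shift]
  exact h v

lemma enc_shift (ω : Config) (n : ℕ) (i j : ℤ) (h : IsEncounterBox ω n i j) :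
    IsEncounterBox (shiftConfig (i, j) ω) n 0 0 := by
  change SetEnc (confSet (shiftConfig (i, j) ω) conf001) (box n 0 0) (box (n + 2) 0 0)
  apply setEnc_preimage (trE (i, j)) (trE_adj _)
  have h1 : trE (i, j) ⁻¹' confSet (shiftConfig (i, j) ω) conf001 = confSet ω conf001 := by
    ext v
    change localConf (shiftConfig (i, j) ω) (trE (i, j) v) = _ ↔ localConf ω v = _
    rw [localConf_shift]
  have h2 : ∀ m : ℕ, trE (i, j) ⁻¹' (box m 0 0) = box m i j := by
    intro m
    ext v
    change (|v.1 - i - 0| ≤ (m : ℤ) ∧ |v.2.1 - j - 0| ≤ (m : ℤ)) ↔ _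
    simp [box]
  rw [h1, h2, h2]
  exact h

lemma measurable_shift (g : ℤ × ℤ) : Measurable (shiftConfig g) :=
  measurable_pi_lambda _ (fun _ => measurable_pi_apply _)

lemma shift_null {μ : Measure Config} (hTI : TransInvariant μ) (B : Set Config) (hB : μ B = 0)
    (g : ℤ × ℤ) : μ (shiftConfig g ⁻¹' B) = 0 := by
  refine measure_mono_null (Set.preimage_mono (subset_toMeasurable μ B)) ?_
  rw [← Measure.map_apply (measurable_shift g) (measurableSet_toMeasurable μ B), hTI g,
    measure_toMeasurable, hB]

end OT

/-- if an ergodic translation-invariant Gibbs measure has almost surely infinitely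
many infinite `{001}`-clusters, then for some `N ≥ 1` the box `B_N` is an encounter box with
positive probability. -/
theorem exists_encounter_box_positive_probability
    (a b c : ℝ) (ha : 0 < a) (hb : 0 < b) (hc : 0 < c)
    (μ : Measure Config) (hGibbs : IsGibbs a b c μ) (hTI : TransInvariant μ)
    (hErg : IsErgodicTI μ)
    (hInf : μ {ω : Config | numInfClusters ω conf001 = ⊤} = 1) :
    ∃ N : ℕ, 1 ≤ N ∧ 0 < μ {ω : Config | IsConfig ω ∧ IsEncounterBox ω N 0 0} := by
  refine ⟨1, le_refl 1, ?_⟩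
  rw [pos_iff_ne_zero]
  intro h0
  have hprob := hGibbs.1
  set B : Set Config := ⋃ g : ℤ × ℤ, shiftConfig g ⁻¹' {ω : Config | IsConfig ω ∧ IsEncounterBox ω 1 0 0}
    with hBdef
  have hB : μ B = 0 := measure_iUnion_null (fun g => OT.shift_null hTI _ h0 g)
  have hfe := OT.finite_energy ha hb hc hGibbs B hB
  have hcompl : μ {ω : Config | IsConfig ω}ᶜ = 0 := by
    rw [prob_compl_eq_zero_iff OT.measurableSet_isConfig]
    exact hGibbs.2.1
  have hsub : {ω : Config | numInfClusters ω conf001 = ⊤} ⊆ {ω : Config | IsConfig ω}ᶜ ∪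
      {ω | IsConfig ω ∧ ∃ ω' ∈ B, IsConfig ω' ∧ {e | ω e ≠ ω' e}.Finite} := by
    intro ω hω
    by_cases hc' : IsConfig ω
    · right
      obtain ⟨ω', ⟨i, j, h1⟩, h2, h3⟩ := OT.selection ω hc' hω
      refine ⟨hc', ω', ?_, h2, h3⟩
      rw [hBdef, Set.mem_iUnion]
      exact ⟨(i, j), OT.isConfig_shift _ _ h2, OT.enc_shift _ _ _ _ h1⟩
    · left; exact hc'
  have hz := measure_mono_null hsub (measure_union_null hcompl hfe)
  rw [hInf] at hz
  exact one_ne_zero hz
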